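/- arXiv:2003.05152 — 2 statements merged into one kernel-verified Lean document; each statement's English description precedes it below -/
import Mathlib

section
/- Let 𝒬̃ = 𝒬₁ ∪ 𝒬₂ ∪ ℒ ⊆ ℂ[x₁,…,xₙ] be a (Q_o,m₁,m₂)-set with rank_s(Q_o) ≥ 100, where 𝒬₂ = {P₁,…,P_{m₂}}. Then for every i ∈ {1,…,m₂} there exists γ_i ∈ ℂ such that rank_s(P_i − γ_i·Q_o) = 2. (The paper assumes rank_s(Q_o) ≥ rkq for an arbitrary sufficiently large absolute constant rkq; rkq = 100 suffices.) -/
open MvPolynomial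

/-- `rankS Q` is the minimal `r` such that `Q = ∑_{i=1}^r a_i · b_i` for linear forms
`a_i, b_i`. -/
noncomputable def rankS {σ : Type*} (Q : MvPolynomial σ ℂ) : ℕ :=
  sInf {r : ℕ | ∃ a b : Fin r → MvPolynomial σ ℂ,
    (∀ i, (a i).IsHomogeneous 1) ∧ (∀ i, (b i).IsHomogeneous 1) ∧ Q = ∑ i, a i * b i}

/-- The family of all polynomials of a `(Q_o,m₁,m₂)`-set: `Q_o`, the `Q_j`'s, the `P_i`'s
and the squares `ℓ_t²`. -/
noncomputable def QoFam {n m₁ m₂ r : ℕ} (Qo : MvPolynomial (Fin n) ℂ)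
    (Qs : Fin m₁ → MvPolynomial (Fin n) ℂ) (Ps : Fin m₂ → MvPolynomial (Fin n) ℂ)
    (ls : Fin r → MvPolynomial (Fin n) ℂ) :
    Unit ⊕ Fin m₁ ⊕ Fin m₂ ⊕ Fin r → MvPolynomial (Fin n) ℂ :=
  Sum.elim (fun _ => Qo) (Sum.elim Qs (Sum.elim Ps fun t => ls t ^ 2))

/-- `𝒬̃ = {Q_o} ∪ {Q_j} ∪ {P_i} ∪ {ℓ_t²}` is a `(Q_o,m₁,m₂)`-set (Definition 4.4 of the
paper). -/
def IsQoSet {n : ℕ} (m₁ m₂ r : ℕ) (Qo : MvPolynomial (Fin n) ℂ)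
    (Qs : Fin m₁ → MvPolynomial (Fin n) ℂ) (Ps : Fin m₂ → MvPolynomial (Fin n) ℂ)
    (ls : Fin r → MvPolynomial (Fin n) ℂ) : Prop :=
  -- the members of 𝒬₁ and 𝒬₂ are irreducible homogeneous quadratics, the ℓ_t are linear
  (Qo.IsHomogeneous 2 ∧ Irreducible Qo) ∧
  (∀ j, (Qs j).IsHomogeneous 2 ∧ Irreducible (Qs j)) ∧
  (∀ i, (Ps i).IsHomogeneous 2 ∧ Irreducible (Ps i)) ∧
  (∀ t, (ls t).IsHomogeneous 1) ∧
  -- (1) pairwise linear independence and the vanishing (radical-membership) condition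
  (∀ i j, i ≠ j →
    LinearIndependent ℂ ![QoFam Qo Qs Ps ls i, QoFam Qo Qs Ps ls j]) ∧
  (∀ i j, i ≠ j →
    (∏ k ∈ (Finset.univ.erase i).erase j, QoFam Qo Qs Ps ls k) ∈
      (Ideal.span {QoFam Qo Qs Ps ls i, QoFam Qo Qs Ps ls j}).radical) ∧
  -- (2)
  (5 * m₂ + 2 < m₁) ∧
  -- (3)
  (∀ j, ∃ a b : MvPolynomial (Fin n) ℂ,
    a.IsHomogeneous 1 ∧ b.IsHomogeneous 1 ∧ Qs j = Qo + a * b) ∧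
  -- (4)
  (∀ i, ∀ α β : ℂ, ¬(α = 0 ∧ β = 0) → 2 ≤ rankS (α • Ps i + β • Qo)) ∧
  -- (5)
  Set.ncard {i : Unit ⊕ Fin m₁ ⊕ Fin m₂ |
    ∃ c d : MvPolynomial (Fin n) ℂ, c.IsHomogeneous 1 ∧ d.IsHomogeneous 1 ∧
      Sum.elim (fun _ => Qo) (Sum.elim Qs Ps) i ∈ Ideal.span {c, d} ∧
      Qo ∈ Ideal.span {c, d}} ≤ m₂

section QuadricPencils

variable {σ : Type*}

/-- A homogeneous factor can be pulled out of a homogeneous component. -/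
lemma homogeneousComponent_homogeneous_mul {g f : MvPolynomial σ ℂ} {k : ℕ}
    (hg : g.IsHomogeneous k) (m : ℕ) :
    homogeneousComponent (k + m) (g * f) = g * homogeneousComponent m f := by
  let _ : GradedAlgebra (homogeneousSubmodule σ ℂ) := gradedAlgebra
  simp only [← decomposition.decompose'_apply]
  exact DirectSum.coe_decompose_mul_add_of_left_mem
      (homogeneousSubmodule σ ℂ) (j := m) (b := f) (a := g) (i := k) hg

/-- A homogeneous factor of too large degree kills a homogeneous component. -/
lemma homogeneousComponent_homogeneous_mul_of_lt {g f : MvPolynomial σ ℂ} {k m : ℕ}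
    (hg : g.IsHomogeneous k) (hm : m < k) :
    homogeneousComponent m (g * f) = 0 := by
  let _ : GradedAlgebra (homogeneousSubmodule σ ℂ) := gradedAlgebra
  simp only [← decomposition.decompose'_apply]
  exact DirectSum.coe_decompose_mul_of_left_mem_of_not_le
      (homogeneousSubmodule σ ℂ) (b := f) (a := g) hg (not_le.mpr hm)

/-- A homogeneous element of an ideal generated by two homogeneous elements of the same degree
is a combination of them with homogeneous coefficients. -/
lemma exists_homogeneous_combination {f a b u v : MvPolynomial σ ℂ} {k m : ℕ}
    (hf : f.IsHomogeneous (k + m)) (ha : a.IsHomogeneous k) (hb : b.IsHomogeneous k)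
    (h : f = a * u + b * v) :
    f = a * homogeneousComponent m u + b * homogeneousComponent m v := by
  have h1 := congrArg (homogeneousComponent (k + m)) h
  rwa [map_add, homogeneousComponent_homogeneous_mul ha, homogeneousComponent_homogeneous_mul hb,
    homogeneousComponent_eq_self hf] at h1

/-- The derivative of a polynomial in the direction of a vector. -/
noncomputable def dirDeriv (p : σ → ℂ) : Derivation ℂ (MvPolynomial σ ℂ) (MvPolynomial σ ℂ) :=
  mkDerivation ℂ fun i => C (p i)

lemma dirDeriv_C_mul (p : σ → ℂ) (c : ℂ) (f : MvPolynomial σ ℂ) :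
    dirDeriv p (C c * f) = C c * dirDeriv p f := by
  rw [← smul_eq_C_mul, Derivation.map_smul, smul_eq_C_mul]

lemma linear_induction {motive : MvPolynomial σ ℂ → Prop} (hX : ∀ i, motive (X i))
    (hzero : motive 0)
    (hadd : ∀ f g, motive f → motive g → motive (f + g))
    (hsmul : ∀ (c : ℂ) f, motive f → motive (c • f))
    {a : MvPolynomial σ ℂ} (ha : a.IsHomogeneous 1) : motive a := by
  have h : a ∈ homogeneousSubmodule σ ℂ 1 := ha
  clear ha
  rw [homogeneousSubmodule_one_eq_span_X] at h
  induction h using Submodule.span_induction with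
  | mem x hx => obtain ⟨i, rfl⟩ := hx; exact hX i
  | zero => exact hzero
  | add x y _ _ hx hy => exact hadd x y hx hy
  | smul c x _ hx => exact hsmul c x hx

lemma quadratic_induction {motive : MvPolynomial σ ℂ → Prop}
    (hmul : ∀ c d : MvPolynomial σ ℂ, c.IsHomogeneous 1 → d.IsHomogeneous 1 → motive (c * d))
    (hadd : ∀ f g, motive f → motive g → motive (f + g))
    {Q : MvPolynomial σ ℂ} (hQ : Q.IsHomogeneous 2) : motive Q := by
  have h : Q ∈ homogeneousSubmodule σ ℂ 2 := hQ
  rw [← homogeneousSubmodule_one_pow, pow_two] at h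
  exact Submodule.mul_induction_on h (fun c hc d hd => hmul c d hc hd) hadd

lemma dirDeriv_linear (p : σ → ℂ) {a : MvPolynomial σ ℂ} (ha : a.IsHomogeneous 1) :
    dirDeriv p a = C (eval p a) := by
  refine linear_induction (motive := fun a => dirDeriv p a = C (eval p a))
    (fun i => ?_) (by simp) (fun f g hf hg => ?_) (fun c f hf => ?_) ha
  · simp [dirDeriv]
  · simp [hf, hg]
  · simp [hf, smul_eq_C_mul]

lemma aeval_line_linear (s t : MvPolynomial σ ℂ) (p : σ → ℂ) {a : MvPolynomial σ ℂ}
    (ha : a.IsHomogeneous 1) :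
    aeval (fun i => s * X i + t * C (p i)) a = s * a + t * C (eval p a) := by
  refine linear_induction (motive := fun a => aeval (fun i => s * X i + t * C (p i)) a = s * a + t * C (eval p a))
    (fun i => ?_) (by simp) (fun f g hf hg => ?_) (fun c f hf => ?_) ha
  · simp
  · simp only [map_add, hf, hg]; ring
  · rw [map_smul, hf, smul_eval, map_mul, smul_eq_C_mul, smul_eq_C_mul]; ring

lemma dirDeriv_mul_linear (p : σ → ℂ) {c d : MvPolynomial σ ℂ} (hc : c.IsHomogeneous 1)
    (hd : d.IsHomogeneous 1) :
    dirDeriv p (c * d) = C (eval p d) * c + C (eval p c) * d := by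
  rw [Derivation.leibniz, dirDeriv_linear p hc, dirDeriv_linear p hd, smul_eq_mul, smul_eq_mul]
  ring

lemma isHomogeneous_dirDeriv (p : σ → ℂ) {Q : MvPolynomial σ ℂ} (hQ : Q.IsHomogeneous 2) :
    (dirDeriv p Q).IsHomogeneous 1 := by
  refine quadratic_induction (motive := fun Q => (dirDeriv p Q).IsHomogeneous 1)
    (fun c d hc hd => ?_) (fun f g hf hg => ?_) hQ
  · rw [dirDeriv_mul_linear p hc hd]
    exact (hc.C_mul _).add (hd.C_mul _)
  · rw [map_add]; exact hf.add hg

/-- Taylor expansion of a quadratic along a line with polynomial parameters. -/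
lemma aeval_line_quadratic (s t : MvPolynomial σ ℂ) (p : σ → ℂ) {Q : MvPolynomial σ ℂ}
    (hQ : Q.IsHomogeneous 2) :
    aeval (fun i => s * X i + t * C (p i)) Q =
      s ^ 2 * Q + s * t * dirDeriv p Q + t ^ 2 * C (eval p Q) := by
  refine quadratic_induction (motive := fun Q => aeval (fun i => s * X i + t * C (p i)) Q = s ^ 2 * Q + s * t * dirDeriv p Q + t ^ 2 * C (eval p Q))
    (fun c d hc hd => ?_) (fun f g hf hg => ?_) hQ
  · rw [map_mul, aeval_line_linear s t p hc, aeval_line_linear s t p hd,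
      dirDeriv_mul_linear p hc hd, map_mul, map_mul]
    ring
  · simp only [map_add, hf, hg]; ring

lemma eval_add_smul_linear {a : MvPolynomial σ ℂ} (ha : a.IsHomogeneous 1) (u v : σ → ℂ) (t : ℂ) :
    eval (u + t • v) a = eval u a + t * eval v a := by
  refine linear_induction (motive := fun a => eval (u + t • v) a = eval u a + t * eval v a)
    (fun i => ?_) (by simp) (fun f g hf hg => ?_) (fun c f hf => ?_) ha
  · simp
  · simp only [map_add, hf, hg]; ring
  · simp only [smul_eval, hf]; ring

lemma eval_dirDeriv_comm {Q : MvPolynomial σ ℂ} (hQ : Q.IsHomogeneous 2) (u v : σ → ℂ) :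
    eval v (dirDeriv u Q) = eval u (dirDeriv v Q) := by
  refine quadratic_induction (motive := fun Q => eval v (dirDeriv u Q) = eval u (dirDeriv v Q))
    (fun c d hc hd => ?_) (fun f g hf hg => ?_) hQ
  · simp only [dirDeriv_mul_linear _ hc hd, map_add, map_mul, eval_C]; ring
  · simp only [map_add, hf, hg]

lemma eval_dirDeriv_self {Q : MvPolynomial σ ℂ} (hQ : Q.IsHomogeneous 2) (u : σ → ℂ) :
    eval u (dirDeriv u Q) = 2 * eval u Q := by
  refine quadratic_induction (motive := fun Q => eval u (dirDeriv u Q) = 2 * eval u Q)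
    (fun c d hc hd => ?_) (fun f g hf hg => ?_) hQ
  · simp only [dirDeriv_mul_linear _ hc hd, map_add, map_mul, eval_C]; ring
  · simp only [map_add, hf, hg]; ring

lemma eval_add_smul_quadratic {Q : MvPolynomial σ ℂ} (hQ : Q.IsHomogeneous 2)
    (u v : σ → ℂ) (t : ℂ) :
    eval (u + t • v) Q = eval u Q + t * eval u (dirDeriv v Q) + t ^ 2 * eval v Q := by
  refine quadratic_induction (motive := fun Q => eval (u + t • v) Q = eval u Q + t * eval u (dirDeriv v Q) + t ^ 2 * eval v Q)
    (fun c d hc hd => ?_) (fun f g hf hg => ?_) hQ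
  · simp only [dirDeriv_mul_linear _ hc hd, map_add, map_mul, eval_C, eval_add_smul_linear hc,
      eval_add_smul_linear hd]
    ring
  · simp only [map_add, hf, hg]; ring

lemma dirDeriv_add_smul {Q : MvPolynomial σ ℂ} (hQ : Q.IsHomogeneous 2)
    (u v : σ → ℂ) (t : ℂ) :
    dirDeriv (u + t • v) Q = dirDeriv u Q + C t * dirDeriv v Q := by
  refine quadratic_induction (motive := fun Q => dirDeriv (u + t • v) Q = dirDeriv u Q + C t * dirDeriv v Q)
    (fun c d hc hd => ?_) (fun f g hf hg => ?_) hQ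
  · simp only [dirDeriv_mul_linear _ hc hd, eval_add_smul_linear hc,
      eval_add_smul_linear hd, map_add, map_mul]
    ring
  · simp only [map_add, hf, hg]; ring

lemma exists_eval_ne_zero {f : MvPolynomial σ ℂ} (hf : f ≠ 0) : ∃ v, eval v f ≠ 0 := by
  by_contra! h
  exact hf (MvPolynomial.funext fun v => by simpa using h v)

lemma exists_root_quadratic (a b c : ℂ) (ha : a ≠ 0) :
    ∃ t s : ℂ, c + t * b + t ^ 2 * a = 0 ∧ s ^ 2 = b ^ 2 - 4 * a * c ∧ b + t * (2 * a) = s := by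
  obtain ⟨s, hs⟩ := IsAlgClosed.exists_pow_nat_eq (b ^ 2 - 4 * a * c) (n := 2) (by norm_num)
  refine ⟨(s - b) / (2 * a), s, ?_, hs, by field_simp; ring⟩
  field_simp
  linear_combination hs

/-- A quadratic which is not a product of two linear forms has a nonsingular zero. -/
lemma exists_nonsingular_zero {Q : MvPolynomial σ ℂ} (hQ : Q.IsHomogeneous 2)
    (hprod : ∀ c d : MvPolynomial σ ℂ, c.IsHomogeneous 1 → d.IsHomogeneous 1 → Q ≠ c * d) :
    ∃ v, eval v Q = 0 ∧ dirDeriv v Q ≠ 0 := by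
  have hQ0 : Q ≠ 0 := by
    intro h
    exact hprod 0 0 (isHomogeneous_zero _ _ _) (isHomogeneous_zero _ _ _) (by simp [h])
  obtain ⟨u, hu⟩ := exists_eval_ne_zero hQ0
  have hdu := isHomogeneous_dirDeriv u hQ
  have hne : Q - C (1 / (4 * eval u Q)) * dirDeriv u Q * dirDeriv u Q ≠ 0 := by
    intro h
    exact hprod _ _ (hdu.C_mul (1 / (4 * eval u Q))) hdu (sub_eq_zero.mp h)
  obtain ⟨w, hw⟩ := exists_eval_ne_zero hne
  obtain ⟨t, s, ht, hs, hts⟩ :=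
    exists_root_quadratic (eval u Q) (eval w (dirDeriv u Q)) (eval w Q) hu
  refine ⟨w + t • u, ?_, ?_⟩
  · rw [eval_add_smul_quadratic hQ, ht]
  · intro h
    have h1 : eval u (dirDeriv (w + t • u) Q) = 0 := by rw [h, map_zero]
    rw [dirDeriv_add_smul hQ, map_add, map_mul, eval_C, eval_dirDeriv_self hQ,
      eval_dirDeriv_comm hQ, hts] at h1
    rw [h1] at hs
    apply hw
    simp only [map_sub, map_mul, eval_C]
    field_simp
    linear_combination hs

/-- The nonsingular zeros of a quadratic which is not a product of two linear forms do not lie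
in a hyperplane. -/
lemma exists_nonsingular_zero_off_hyperplane {Q m : MvPolynomial σ ℂ} (hQ : Q.IsHomogeneous 2)
    (hprod : ∀ c d : MvPolynomial σ ℂ, c.IsHomogeneous 1 → d.IsHomogeneous 1 → Q ≠ c * d)
    (hm : m.IsHomogeneous 1) (hm0 : m ≠ 0) :
    ∃ v, eval v Q = 0 ∧ dirDeriv v Q ≠ 0 ∧ eval v m ≠ 0 := by
  obtain ⟨v, hv, hdv⟩ := exists_nonsingular_zero hQ hprod
  by_cases hmv : eval v m = 0
  swap
  · exact ⟨v, hv, hdv, hmv⟩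
  obtain ⟨u, hu⟩ := exists_eval_ne_zero (mul_ne_zero hm0 hdv)
  rw [map_mul] at hu
  have hmu := left_ne_zero_of_mul hu
  have hdu := right_ne_zero_of_mul hu
  refine ⟨u + (-eval u Q / eval u (dirDeriv v Q)) • v, ?_, ?_, ?_⟩
  · rw [eval_add_smul_quadratic hQ, hv]
    field_simp
    ring
  · intro h
    apply hdu
    have h1 := congrArg (eval v) h
    rw [dirDeriv_add_smul hQ, map_add, map_mul, eval_dirDeriv_self hQ, hv] at h1
    rw [eval_dirDeriv_comm hQ]
    simpa using h1
  · rw [eval_add_smul_linear hm, hmv]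
    simpa using hmu

/-- A quadratic of rank at least three has a common zero with any other quadratic at which it is
nonsingular. -/
lemma exists_common_zero {A B : MvPolynomial σ ℂ} (hA : A.IsHomogeneous 2)
    (hB : B.IsHomogeneous 2)
    (hrank : ∀ c₁ d₁ c₂ d₂ : MvPolynomial σ ℂ, c₁.IsHomogeneous 1 → d₁.IsHomogeneous 1 →
      c₂.IsHomogeneous 1 → d₂.IsHomogeneous 1 → A ≠ c₁ * d₁ + c₂ * d₂) :
    ∃ p, eval p A = 0 ∧ eval p B = 0 ∧ dirDeriv p A ≠ 0 := by
  have h0 : (0 : MvPolynomial σ ℂ).IsHomogeneous 1 := isHomogeneous_zero _ _ _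
  obtain ⟨v, hv, hdv⟩ := exists_nonsingular_zero hA fun c d hc hd h =>
    hrank c d 0 0 hc hd h0 h0 (by simp [h])
  obtain ⟨w, hw, hvw⟩ : ∃ w, eval w A = 0 ∧ eval w (dirDeriv v A) ≠ 0 := by
    obtain ⟨w, hw⟩ := exists_eval_ne_zero hdv
    refine ⟨w + (-eval w A / eval w (dirDeriv v A)) • v, ?_, ?_⟩
    · rw [eval_add_smul_quadratic hA, hv]
      field_simp
      ring
    · rw [eval_add_smul_linear (isHomogeneous_dirDeriv v hA), eval_dirDeriv_self hA, hv]
      simpa using hw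
  set k := eval w (dirDeriv v A) with hk
  have hlv := isHomogeneous_dirDeriv v hA
  have hlw := isHomogeneous_dirDeriv w hA
  have hA' : (A - C (1 / k) * dirDeriv v A * dirDeriv w A).IsHomogeneous 2 :=
    hA.sub ((hlv.C_mul _).mul hlw)
  obtain ⟨z, hz, hdz⟩ := exists_nonsingular_zero hA' fun c d hc hd h =>
    hrank c d _ _ hc hd (hlv.C_mul (1 / k)) hlw (by rw [← h]; ring)
  set x := eval z (dirDeriv v A) with hx
  set y := eval z (dirDeriv w A) with hy
  set z' := z + (-y / k) • v + (-x / k) • w with hz'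
  have hwv : eval v (dirDeriv w A) = k := eval_dirDeriv_comm hA w v
  have hz'A : eval z' A = 0 := by
    simp only [map_sub, map_mul, eval_C, ← hx, ← hy] at hz
    rw [hz', eval_add_smul_quadratic hA, eval_add_smul_quadratic hA,
      eval_add_smul_linear hlw, hv, hw, ← hx, ← hy, hwv]
    field_simp
    field_simp at hz
    linear_combination k * hz
  have hz'v : eval z' (dirDeriv v A) = 0 := by
    rw [hz', eval_add_smul_linear hlv, eval_add_smul_linear hlv, eval_dirDeriv_self hA, hv, ← hx,
      ← hk]
    field_simp
    ring
  have hz'w : eval w (dirDeriv z' A) = 0 := by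
    rw [eval_dirDeriv_comm hA, hz', eval_add_smul_linear hlw, eval_add_smul_linear hlw,
      eval_dirDeriv_self hA, hw, ← hy, hwv]
    field_simp
    ring
  have hdz' : dirDeriv z' A ≠ 0 := by
    intro h
    apply hdz
    rw [hz', dirDeriv_add_smul hA, dirDeriv_add_smul hA] at h
    rw [map_sub, mul_assoc, dirDeriv_C_mul, dirDeriv_mul_linear z hlv hlw, ← hx, ← hy]
    simp only [map_neg, div_eq_mul_inv, map_mul, one_mul] at h ⊢
    linear_combination h
  by_cases hBz : eval z' B = 0
  · exact ⟨z', hz'A, hBz, hdz'⟩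
  obtain ⟨t, -, ht, -⟩ := exists_root_quadratic (eval z' B) (eval v (dirDeriv z' B)) (eval v B) hBz
  refine ⟨v + t • z', ?_, ?_, ?_⟩
  · rw [eval_add_smul_quadratic hA, hv, hz'A, eval_dirDeriv_comm hA, hz'v]
    ring
  · rw [eval_add_smul_quadratic hB, ht]
  · intro h
    apply hvw
    have h1 := congrArg (eval w) h
    rw [dirDeriv_add_smul hA, map_add, map_mul, hz'w] at h1
    simpa using h1

/-- The intersection of two quadrics spanning a pencil without members of rank one, one of
them of rank at least three, has a nonsingular point. -/
lemma exists_nonsingular_common_zero {A B : MvPolynomial σ ℂ} (hA : A.IsHomogeneous 2)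
    (hB : B.IsHomogeneous 2)
    (hrank : ∀ c₁ d₁ c₂ d₂ : MvPolynomial σ ℂ, c₁.IsHomogeneous 1 → d₁.IsHomogeneous 1 →
      c₂.IsHomogeneous 1 → d₂.IsHomogeneous 1 → A ≠ c₁ * d₁ + c₂ * d₂)
    (hpencil : ∀ (γ : ℂ) (c d : MvPolynomial σ ℂ), c.IsHomogeneous 1 → d.IsHomogeneous 1 →
      B - C γ * A ≠ c * d) :
    ∃ p, eval p A = 0 ∧ eval p B = 0 ∧ dirDeriv p A ≠ 0 ∧
      ∀ γ : ℂ, dirDeriv p B ≠ C γ * dirDeriv p A := by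
  obtain ⟨q, hqA, hqB, hdq⟩ := exists_common_zero hA hB hrank
  by_cases hind : ∀ γ : ℂ, dirDeriv q B ≠ C γ * dirDeriv q A
  · exact ⟨q, hqA, hqB, hdq, hind⟩
  push Not at hind
  obtain ⟨μ, hμ⟩ := hind
  have hR : (B - C μ * A).IsHomogeneous 2 := hB.sub (hA.C_mul μ)
  have hDR : ∀ p, dirDeriv p (B - C μ * A) = dirDeriv p B - C μ * dirDeriv p A := fun p => by
    rw [map_sub, dirDeriv_C_mul]
  obtain ⟨v, hv, hdv, hqv⟩ := exists_nonsingular_zero_off_hyperplane hR (hpencil μ)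
    (isHomogeneous_dirDeriv q hA) hdq
  set t := -eval v A / eval v (dirDeriv q A) with ht
  have hpA : eval (v + t • q) A = 0 := by
    rw [eval_add_smul_quadratic hA, hqA, ht]
    field_simp
    ring
  have hAq : eval q (dirDeriv (v + t • q) A) ≠ 0 := by
    rw [eval_dirDeriv_comm hA, eval_add_smul_linear (isHomogeneous_dirDeriv q hA),
      eval_dirDeriv_self hA, hqA]
    simpa using hqv
  have hRq : dirDeriv q (B - C μ * A) = 0 := by rw [hDR, hμ, sub_self]
  have hpR : eval (v + t • q) (B - C μ * A) = 0 := by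
    rw [eval_add_smul_quadratic hR, hv, hRq, map_sub, map_mul, hqA, hqB]
    simp
  refine ⟨v + t • q, hpA, ?_, fun h => hAq (by rw [h, map_zero]), fun γ hγ => ?_⟩
  · rw [map_sub, map_mul, hpA] at hpR
    simpa using hpR
  · have hdR : dirDeriv (v + t • q) (B - C μ * A) = C (γ - μ) * dirDeriv (v + t • q) A := by
      rw [hDR, hγ, C_sub]; ring
    have h0 : eval q (dirDeriv (v + t • q) (B - C μ * A)) = 0 := by
      rw [eval_dirDeriv_comm hR, hRq, map_zero]
    rw [hdR, map_mul, eval_C] at h0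
    have hγμ : γ - μ = 0 := (mul_eq_zero.mp h0).resolve_right hAq
    rw [hγμ, C_0, zero_mul, dirDeriv_add_smul hR, hRq, mul_zero, add_zero] at hdR
    exact hdv hdR

/-- Polynomials restrict to the hyperplane cut out by a linear form. -/
lemma exists_retraction {a : MvPolynomial σ ℂ} (ha : a.IsHomogeneous 1) :
    ∃ ψ : MvPolynomial σ ℂ →ₐ[ℂ] MvPolynomial σ ℂ, ψ a = 0 ∧ (∀ f, a ∣ f - ψ f) ∧
      ∀ l : MvPolynomial σ ℂ, l.IsHomogeneous 1 → (ψ l).IsHomogeneous 1 := by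
  by_cases ha0 : a = 0
  · exact ⟨AlgHom.id _ _, by simp [ha0], by simp, fun l hl => hl⟩
  obtain ⟨u, hu⟩ := exists_eval_ne_zero ha0
  refine ⟨aeval fun i => 1 * X i + -(C (eval u a)⁻¹ * a) * C (u i), ?_, fun f => ?_, fun l hl => ?_⟩
  · have hC : C (eval u a)⁻¹ * C (eval u a) = (1 : MvPolynomial σ ℂ) := by
      rw [← C_mul, inv_mul_cancel₀ hu, C_1]
    rw [aeval_line_linear _ _ _ ha]
    linear_combination -a * hC
  · induction f using MvPolynomial.induction_on with
    | C c => simp [algebraMap_eq]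
    | add f g hf hg => rw [map_add, add_sub_add_comm]; exact dvd_add hf hg
    | mul_X f i hf =>
      obtain ⟨g, hg⟩ := hf
      rw [map_mul, aeval_X]
      refine ⟨g * X i + aeval (fun i => 1 * X i + -(C (eval u a)⁻¹ * a) * C (u i)) f *
        (C (eval u a)⁻¹ * C (u i)), ?_⟩
      linear_combination X i * hg
  · rw [aeval_line_linear _ _ _ hl, one_mul]
    refine hl.add ?_
    rw [mul_comm]
    exact ((ha.C_mul _).neg).C_mul _

lemma prime_of_linear {a : MvPolynomial σ ℂ} (ha : a.IsHomogeneous 1) (ha0 : a ≠ 0) :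
    Prime a := by
  obtain ⟨ψ, hψa, hψ, -⟩ := exists_retraction ha
  have hdvd : ∀ f, ψ f = 0 → a ∣ f := fun f hf => by simpa [hf] using hψ f
  refine ⟨ha0, fun h => ?_, fun f g h => ?_⟩
  · have := h.map ψ
    rw [hψa] at this
    exact not_isUnit_zero this
  · obtain ⟨k, hk⟩ := h
    have h0 : ψ f * ψ g = 0 := by rw [← map_mul, hk, map_mul, hψa, zero_mul]
    exact (mul_eq_zero.mp h0).imp (hdvd f) (hdvd g)

/-- The ideal generated by two linear forms is prime. -/
lemma mem_or_mem_span_pair_linear {a b f g : MvPolynomial σ ℂ} (ha : a.IsHomogeneous 1)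
    (hb : b.IsHomogeneous 1) (h : f * g ∈ Ideal.span {a, b}) :
    f ∈ Ideal.span {a, b} ∨ g ∈ Ideal.span {a, b} := by
  obtain ⟨ψ, hψa, hψ, hψl⟩ := exists_retraction ha
  obtain ⟨χ, hχb, hχ, -⟩ := exists_retraction (hψl b hb)
  have hmem : ∀ f, χ (ψ f) = 0 → f ∈ Ideal.span {a, b} := fun f hf => by
    obtain ⟨k₁, h₁⟩ := hψ f
    obtain ⟨k₂, h₂⟩ := hχ (ψ f)
    obtain ⟨k₃, h₃⟩ := hψ b
    rw [Ideal.mem_span_pair]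
    refine ⟨k₁ - k₂ * k₃, k₂, ?_⟩
    linear_combination -h₁ - h₂ - hf + k₂ * h₃
  obtain ⟨u, v, huv⟩ := Ideal.mem_span_pair.mp h
  have h0 : χ (ψ f) * χ (ψ g) = 0 := by
    rw [← map_mul, ← map_mul, ← huv]
    simp [hψa, hχb]
  exact (mul_eq_zero.mp h0).imp (hmem f) (hmem g)

lemma eq_C_mul_of_dvd_linear {a b : MvPolynomial σ ℂ} (ha : a.IsHomogeneous 1)
    (hb : b.IsHomogeneous 1) (h : a ∣ b) : ∃ γ : ℂ, b = C γ * a := by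
  obtain ⟨u, hu⟩ := h
  have h1 := exists_homogeneous_combination (m := 0) (b := 0) (v := 0) hb ha
    (isHomogeneous_zero _ _ _) (by simpa using hu)
  rw [homogeneousComponent_zero] at h1
  exact ⟨coeff 0 u, by rw [h1]; ring⟩

lemma eq_mul_of_linear_dvd_quadratic {a Q : MvPolynomial σ ℂ} (ha : a.IsHomogeneous 1)
    (hQ : Q.IsHomogeneous 2) (h : a ∣ Q) :
    ∃ d : MvPolynomial σ ℂ, d.IsHomogeneous 1 ∧ Q = a * d := by
  obtain ⟨u, hu⟩ := h
  have h1 := exists_homogeneous_combination (m := 1) (b := 0) (v := 0) hQ ha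
    (isHomogeneous_zero _ _ _) (by simpa using hu)
  exact ⟨_, homogeneousComponent_isHomogeneous 1 u, by simpa using h1⟩

/-- A nonzero homogeneous cubic without linear factors is irreducible. -/
lemma irreducible_cubic {F : MvPolynomial σ ℂ} (hF : F.IsHomogeneous 3) (hF0 : F ≠ 0)
    (hlin : ∀ l : MvPolynomial σ ℂ, l.IsHomogeneous 1 → ¬ l ∣ F) : Irreducible F := by
  have key : ∀ G H : MvPolynomial σ ℂ, F = G * H → G.totalDegree = 1 → H.totalDegree = 2 →
      False := by
    intro G H hGH hG hH
    have hsum : G = C (coeff 0 G) + homogeneousComponent 1 G := by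
      conv_lhs => rw [← sum_homogeneousComponent G, hG]
      simp [Finset.sum_range_succ]
    apply hlin _ (homogeneousComponent_isHomogeneous 1 G)
    refine ⟨homogeneousComponent 2 H, ?_⟩
    have h := homogeneousComponent_eq_self hF
    conv_lhs at h => rw [hGH, hsum, add_mul, map_add, homogeneousComponent_C_mul,
      homogeneousComponent_eq_zero 3 H (by omega)]
    rw [← h, ← homogeneousComponent_homogeneous_mul (homogeneousComponent_isHomogeneous 1 G)]
    simp
  have hunit : ∀ G : MvPolynomial σ ℂ, G ≠ 0 → G.totalDegree = 0 → IsUnit G := by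
    intro G hG0 hG
    rw [totalDegree_eq_zero_iff_eq_C] at hG
    rw [hG] at hG0 ⊢
    exact (isUnit_iff_ne_zero.mpr fun h => hG0 (by rw [h, C_0])).map C
  refine ⟨fun h => ?_, fun G H hGH => ?_⟩
  · have h3 := hF.totalDegree hF0
    rw [isUnit_iff_totalDegree_of_isReduced] at h
    omega
  · have hG0 : G ≠ 0 := fun h => hF0 (by rw [hGH, h, zero_mul])
    have hH0 : H ≠ 0 := fun h => hF0 (by rw [hGH, h, mul_zero])
    have hdeg := hF.totalDegree hF0
    rw [hGH, totalDegree_mul_of_isDomain hG0 hH0] at hdeg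
    by_contra! hne
    have hG := mt (hunit G hG0) hne.1
    have hH := mt (hunit H hH0) hne.2
    rcases (by omega : G.totalDegree = 1 ∧ H.totalDegree = 2 ∨
      H.totalDegree = 1 ∧ G.totalDegree = 2) with h | h
    · exact key G H hGH h.1 h.2
    · exact key H G (by rw [hGH, mul_comm]) h.1 h.2

/-- Projecting the intersection of two quadrics from a nonsingular point yields an irreducible
cubic. -/
lemma prime_projection_cubic {A B a b : MvPolynomial σ ℂ} (hA : A.IsHomogeneous 2)
    (hB : B.IsHomogeneous 2) (ha : a.IsHomogeneous 1) (hb : b.IsHomogeneous 1) (ha0 : a ≠ 0)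
    (hab : ∀ γ : ℂ, b ≠ C γ * a)
    (hrank : ∀ c d : MvPolynomial σ ℂ, c.IsHomogeneous 1 → d.IsHomogeneous 1 →
      A ∉ Ideal.span {c, d})
    (hpencil : ∀ (γ : ℂ) (c d : MvPolynomial σ ℂ), c.IsHomogeneous 1 → d.IsHomogeneous 1 →
      B - C γ * A ≠ c * d) :
    Prime (a * B - b * A) := by
  have hnot : ∀ c : MvPolynomial σ ℂ, c.IsHomogeneous 1 → ¬ c ∣ A := fun c hc h =>
    hrank c c hc hc (Ideal.mem_of_dvd _ h (Ideal.subset_span (by simp)))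
  have hF0 : a * B - b * A ≠ 0 := by
    intro h
    rcases (prime_of_linear ha ha0).dvd_or_dvd (Dvd.intro B (sub_eq_zero.mp h)) with h | h
    · obtain ⟨γ, hγ⟩ := eq_C_mul_of_dvd_linear ha hb h
      exact hab γ hγ
    · exact hnot a ha h
  refine (irreducible_cubic ((ha.mul hB).sub (hb.mul hA)) hF0 fun l hl ⟨u, hu⟩ => ?_).prime
  by_cases hbl : b ∈ Ideal.span {a, l}
  · obtain ⟨x, y, hxy⟩ := Ideal.mem_span_pair.mp hbl
    have hb' := exists_homogeneous_combination (m := 0) (u := x) (v := y) hb ha hl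
      (by rw [← hxy]; ring)
    rw [homogeneousComponent_zero, homogeneousComponent_zero] at hb'
    have hl0 : l ≠ 0 := fun h => hF0 (by rw [hu, h, zero_mul])
    have hdvd : l ∣ a * (B - C (coeff 0 x) * A) :=
      ⟨u + C (coeff 0 y) * A, by linear_combination hu + A * hb'⟩
    rcases (prime_of_linear hl hl0).dvd_or_dvd hdvd with h | h
    · obtain ⟨γ, hγ⟩ := eq_C_mul_of_dvd_linear hl ha h
      have hγ0 : γ ≠ 0 := fun h0 => ha0 (by rw [hγ, h0, C_0, zero_mul])
      have hC : C γ⁻¹ * C γ = (1 : MvPolynomial σ ℂ) := by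
        rw [← C_mul, inv_mul_cancel₀ hγ0, C_1]
      apply hab (coeff 0 x + coeff 0 y * γ⁻¹)
      rw [C_add, C_mul]
      linear_combination hb' - l * C (coeff 0 y) * hC - C (coeff 0 y) * C γ⁻¹ * hγ
    · obtain ⟨d, hd, h⟩ := eq_mul_of_linear_dvd_quadratic hl (hB.sub (hA.C_mul _)) h
      exact hpencil _ l d hl hd h
  · have hmem : b * A ∈ Ideal.span {a, l} :=
      Ideal.mem_span_pair.mpr ⟨B, -u, by linear_combination hu⟩
    exact hrank a l ha hl ((mem_or_mem_span_pair_linear ha hl hmem).resolve_left hbl)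

/-- If the product of quadratics vanishes on the intersection of two quadrics spanning a pencil
without members of rank one, one of them of rank at least three, then one of the factors lies in
the pencil. -/
theorem exists_mem_pencil_of_prod_mem_radical {ι : Type*} {A B : MvPolynomial σ ℂ}
    (hA : A.IsHomogeneous 2) (hB : B.IsHomogeneous 2)
    (hrank : ∀ c₁ d₁ c₂ d₂ : MvPolynomial σ ℂ, c₁.IsHomogeneous 1 → d₁.IsHomogeneous 1 →
      c₂.IsHomogeneous 1 → d₂.IsHomogeneous 1 → A ≠ c₁ * d₁ + c₂ * d₂)
    (hpencil : ∀ (γ : ℂ) (c d : MvPolynomial σ ℂ), c.IsHomogeneous 1 → d.IsHomogeneous 1 →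
      B - C γ * A ≠ c * d)
    (s : Finset ι) (Q : ι → MvPolynomial σ ℂ) (hQ : ∀ i ∈ s, (Q i).IsHomogeneous 2)
    (hprod : ∏ i ∈ s, Q i ∈ (Ideal.span {A, B}).radical) :
    ∃ i ∈ s, ∃ γ δ : ℂ, Q i = C γ * A + C δ * B := by
  have hrank' : ∀ c d : MvPolynomial σ ℂ, c.IsHomogeneous 1 → d.IsHomogeneous 1 →
      A ∉ Ideal.span {c, d} := by
    intro c d hc hd h
    obtain ⟨u, v, huv⟩ := Ideal.mem_span_pair.mp h
    exact hrank _ _ _ _ hc (homogeneousComponent_isHomogeneous 1 u) hd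
      (homogeneousComponent_isHomogeneous 1 v)
      (exists_homogeneous_combination (m := 1) hA hc hd (by rw [← huv]; ring))
  obtain ⟨p, hpA, hpB, ha0, hab⟩ := exists_nonsingular_common_zero hA hB hrank hpencil
  have ha := isHomogeneous_dirDeriv p hA
  have hb := isHomogeneous_dirDeriv p hB
  have hTaylor := fun {R : MvPolynomial σ ℂ} (hR : R.IsHomogeneous 2) =>
    aeval_line_quadratic (dirDeriv p A) (-A) p hR
  set a := dirDeriv p A
  set b := dirDeriv p B
  have hF : Prime (a * B - b * A) := prime_projection_cubic hA hB ha hb ha0 hab hrank' hpencil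
  have haA : ¬ a ∣ A := fun h =>
    hrank' a a ha ha (Ideal.mem_of_dvd _ h (Ideal.subset_span (by simp)))
  obtain ⟨N, hN⟩ := hprod
  obtain ⟨u, v, huv⟩ := Ideal.mem_span_pair.mp hN
  have hdvd : a * B - b * A ∣
      aeval (fun i => a * X i + -A * C (p i)) (∏ i ∈ s, Q i) ^ N := by
    rw [← map_pow, ← huv, map_add, map_mul, map_mul, hTaylor hA, hTaylor hB, hpA, hpB]
    exact ⟨aeval (fun i => a * X i + -A * C (p i)) v * a, by rw [C_0]; ring⟩
  replace hdvd := hF.dvd_of_dvd_pow hdvd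
  rw [map_prod, hF.dvd_finsetProd_iff] at hdvd
  obtain ⟨i, hi, w, hw⟩ := hdvd
  refine ⟨i, hi, ?_⟩
  rw [hTaylor (hQ i hi)] at hw
  have hq : eval p (Q i) = 0 := by
    by_contra hq
    have hC : C (eval p (Q i))⁻¹ * C (eval p (Q i)) = (1 : MvPolynomial σ ℂ) := by
      rw [← C_mul, inv_mul_cancel₀ hq, C_1]
    have hdvd : a ∣ A * (C (eval p (Q i)) * A + b * w) :=
      ⟨B * w - a * Q i + A * dirDeriv p (Q i), by linear_combination hw⟩
    obtain ⟨k, hk⟩ := ((prime_of_linear ha ha0).dvd_or_dvd hdvd).resolve_left haA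
    refine hrank' a b ha hb (Ideal.mem_span_pair.mpr
      ⟨C (eval p (Q i))⁻¹ * k, -C (eval p (Q i))⁻¹ * w, ?_⟩)
    linear_combination A * hC - C (eval p (Q i))⁻¹ * hk
  rw [hq, C_0] at hw
  have hFa : ¬ a * B - b * A ∣ a := by
    rintro ⟨k, hk⟩
    have h1 := homogeneousComponent_homogeneous_mul_of_lt (f := k) (m := 1)
      ((ha.mul hB).sub (hb.mul hA)) (by norm_num)
    rw [← hk, homogeneousComponent_eq_self ha] at h1
    exact ha0 h1
  obtain ⟨c, hc⟩ := (hF.dvd_or_dvd (a := a) (b := a * Q i - A * dirDeriv p (Q i))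
    ⟨w, by linear_combination hw⟩).resolve_left hFa
  obtain ⟨k, hk⟩ := ((prime_of_linear ha ha0).dvd_or_dvd
    (a := A) (b := c * b - dirDeriv p (Q i)) ⟨c * B - Q i, by linear_combination hc⟩).resolve_left haA
  have hQi : Q i = A * (-k) + B * c := by
    apply mul_left_cancel₀ ha0
    linear_combination hc - A * hk
  have h := exists_homogeneous_combination (m := 0) (hQ i hi) hA hB hQi
  rw [homogeneousComponent_zero, homogeneousComponent_zero] at h
  exact ⟨coeff 0 (-k), coeff 0 c, by linear_combination h⟩

end QuadricPencils

lemma rankS_le {σ : Type*} {r : ℕ} {Q : MvPolynomial σ ℂ} (a b : Fin r → MvPolynomial σ ℂ)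
    (ha : ∀ i, (a i).IsHomogeneous 1) (hb : ∀ i, (b i).IsHomogeneous 1)
    (h : Q = ∑ i, a i * b i) : rankS Q ≤ r :=
  Nat.sInf_le ⟨a, b, ha, hb, h⟩

lemma rankS_add_mul_le_two {σ : Type*} {Q c₁ d₁ c₂ d₂ : MvPolynomial σ ℂ}
    (hc₁ : c₁.IsHomogeneous 1) (hd₁ : d₁.IsHomogeneous 1) (hc₂ : c₂.IsHomogeneous 1)
    (hd₂ : d₂.IsHomogeneous 1) (h : Q = c₁ * d₁ + c₂ * d₂) : rankS Q ≤ 2 :=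
  rankS_le ![c₁, c₂] ![d₁, d₂] (by simp [Fin.forall_fin_two, hc₁, hc₂])
    (by simp [Fin.forall_fin_two, hd₁, hd₂]) (by simp [h])

lemma rankS_add_mul_add_mul_le_three {σ : Type*} {Q c₁ d₁ c₂ d₂ c₃ d₃ : MvPolynomial σ ℂ}
    (hc₁ : c₁.IsHomogeneous 1) (hd₁ : d₁.IsHomogeneous 1) (hc₂ : c₂.IsHomogeneous 1)
    (hd₂ : d₂.IsHomogeneous 1) (hc₃ : c₃.IsHomogeneous 1) (hd₃ : d₃.IsHomogeneous 1)
    (h : Q = c₁ * d₁ + c₂ * d₂ + c₃ * d₃) : rankS Q ≤ 3 :=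
  rankS_le ![c₁, c₂, c₃] ![d₁, d₂, d₃] (by simp [Fin.forall_fin_succ, hc₁, hc₂, hc₃])
    (by simp [Fin.forall_fin_succ, hd₁, hd₂, hd₃]) (by simp [h, Fin.sum_univ_three])

/-- Claim 5.8 of the paper. For a `(Q_o,m₁,m₂)`-set with
`rank_s(Q_o) ≥ 100`, every `P_i ∈ 𝒬₂` satisfies `rank_s(P_i − γ_i·Q_o) = 2` for some
`γ_i ∈ ℂ`. -/
theorem statement18 {n m₁ m₂ r : ℕ} (Qo : MvPolynomial (Fin n) ℂ)
    (Qs : Fin m₁ → MvPolynomial (Fin n) ℂ) (Ps : Fin m₂ → MvPolynomial (Fin n) ℂ)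
    (ls : Fin r → MvPolynomial (Fin n) ℂ)
    (hset : IsQoSet m₁ m₂ r Qo Qs Ps ls)
    (hrk : 100 ≤ rankS Qo) :
    ∀ i : Fin m₂, ∃ γ : ℂ, rankS (Ps i - γ • Qo) = 2 := by
  obtain ⟨⟨hQo, -⟩, hQs, hPs, hls, hind, hrad, hm, hab, hrk2, -⟩ := hset
  intro i
  by_contra! hcon
  have hnot : ∀ x y : ℂ, x ≠ 0 → ∀ c₁ d₁ c₂ d₂ : MvPolynomial (Fin n) ℂ, c₁.IsHomogeneous 1 →
      d₁.IsHomogeneous 1 → c₂.IsHomogeneous 1 → d₂.IsHomogeneous 1 →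
      C x * Ps i ≠ C y * Qo + c₁ * d₁ + c₂ * d₂ := by
    intro x y hx c₁ d₁ c₂ d₂ hc₁ hd₁ hc₂ hd₂ h
    have hC : C x⁻¹ * C x = (1 : MvPolynomial (Fin n) ℂ) := by
      rw [← C_mul, inv_mul_cancel₀ hx, C_1]
    refine hcon (x⁻¹ * y) (le_antisymm ?_ ?_)
    · refine rankS_add_mul_le_two (hc₁.C_mul x⁻¹) hd₁ (hc₂.C_mul x⁻¹) hd₂ ?_
      rw [smul_eq_C_mul, C_mul]
      linear_combination C x⁻¹ * h - Ps i * hC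
    · have := hrk2 i 1 (-(x⁻¹ * y)) (by simp)
      rwa [one_smul, neg_smul, ← sub_eq_add_neg] at this
  have hne : ∀ k l, k ≠ l → ∀ x y : ℂ, C x * QoFam Qo Qs Ps ls k + C y * QoFam Qo Qs Ps ls l = 0 →
      x = 0 ∧ y = 0 := by
    intro k l hkl x y h
    have := LinearIndependent.pair_iff.mp (hind k l hkl) x y
    rw [smul_eq_C_mul, smul_eq_C_mul] at this
    exact this h
  choose a b ha hb hQab using hab
  -- `P_i` is not in the span of two of the polynomials `Q_o + a * b`
  have hspan : ∀ (j j' : Fin m₁) (x y z : ℂ), x ≠ 0 →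
      C x * Ps i ≠ C y * Qs j + C z * Qs j' := by
    intro j j' x y z hx h
    refine hnot x (y + z) hx _ _ _ _ ((ha j).C_mul y) (hb j) ((ha j').C_mul z) (hb j') ?_
    rw [h, hQab j, hQab j', C_add]
    ring
  have h0 : (0 : MvPolynomial (Fin n) ℂ).IsHomogeneous 1 := isHomogeneous_zero _ _ _
  have hthird : ∀ j, ∃ i', i' ≠ i ∧ ∃ x y : ℂ, Ps i' = C x * Qs j + C y * Ps i := by
    intro j
    have hne' : (Sum.inr (Sum.inl j) : Unit ⊕ Fin m₁ ⊕ Fin m₂ ⊕ Fin r) ≠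
        Sum.inr (Sum.inr (Sum.inl i)) := by simp
    have hr : ∏ k ∈ (Finset.univ.erase (Sum.inr (Sum.inl j))).erase
        (Sum.inr (Sum.inr (Sum.inl i))), QoFam Qo Qs Ps ls k ∈
          (Ideal.span {Qs j, Ps i}).radical := by
      simpa only [QoFam, Sum.elim_inr, Sum.elim_inl] using hrad _ _ hne'
    obtain ⟨k, hk, x, y, hxy⟩ := exists_mem_pencil_of_prod_mem_radical (hQs j).1 (hPs i).1
      (fun c₁ d₁ c₂ d₂ hc₁ hd₁ hc₂ hd₂ h => by
        have := rankS_add_mul_add_mul_le_three (Q := Qo) hc₁ hd₁ hc₂ hd₂ (ha j).neg (hb j)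
          (by linear_combination h - hQab j)
        omega)
      (fun γ c d hc hd h => hnot 1 γ one_ne_zero c d _ _ hc hd ((ha j).C_mul γ) (hb j) (by
        rw [C_1]; linear_combination h + C γ * hQab j))
      _ (QoFam Qo Qs Ps ls) (fun k _ => by
        rcases k with k | k | k | k
        · exact hQo
        · exact (hQs k).1
        · exact (hPs k).1
        · exact (hls k).pow 2)
      hr
    have hkj : k ≠ Sum.inr (Sum.inl j) := (Finset.mem_erase.mp (Finset.mem_erase.mp hk).2).1
    have hki : k ≠ Sum.inr (Sum.inr (Sum.inl i)) := (Finset.mem_erase.mp hk).1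
    have hy : y ≠ 0 := by
      intro hy
      have := (hne k _ hkj 1 (-x) (by
        rw [hxy, hy, C_0, C_1, C_neg]; simp only [QoFam, Sum.elim_inr, Sum.elim_inl]; ring)).1
      exact one_ne_zero this
    rcases k with k | j' | i' | t
    · refine absurd ?_ (hnot y (1 - x) hy _ _ _ _ ((ha j).C_mul (-x)) (hb j) h0 h0)
      have hxy' : Qo = C x * Qs j + C y * Ps i := hxy
      rw [C_sub, C_neg, C_1]
      linear_combination -hxy' - C x * hQab j
    · refine absurd ?_ (hspan j' j y 1 (-x) hy)
      have hxy' : Qs j' = C x * Qs j + C y * Ps i := hxy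
      rw [C_neg, C_1]
      linear_combination -hxy'
    · exact ⟨i', fun h => hki (by rw [h]), x, y, hxy⟩
    · refine absurd ?_ (hnot y (-x) hy _ _ _ _ ((ha j).C_mul (-x)) (hb j) (hls t) (hls t))
      have hxy' : ls t ^ 2 = C x * Qs j + C y * Ps i := hxy
      rw [C_neg]
      linear_combination -hxy' - C x * hQab j
  choose f hfi x y hf using hthird
  obtain ⟨j, j', hjj, hff⟩ := Fintype.exists_ne_map_eq_of_card_lt f (by simp; omega)
  have hx : x j ≠ 0 := by
    intro hx
    have := (hne (Sum.inr (Sum.inr (Sum.inl (f j)))) (Sum.inr (Sum.inr (Sum.inl i)))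
      (by simpa using hfi j) 1 (-y j) (by
        simp only [QoFam, Sum.elim_inr, Sum.elim_inl]
        rw [hf j, hx, C_0, C_1, C_neg]; ring)).1
    exact one_ne_zero this
  have heq : C (x j) * Qs j + C (y j) * Ps i = C (x j') * Qs j' + C (y j') * Ps i := by
    rw [← hf j, ← hf j', hff]
  by_cases hy : y j - y j' = 0
  · refine hx (hne (Sum.inr (Sum.inl j)) (Sum.inr (Sum.inl j')) (by simpa using hjj)
      (x j) (-x j') ?_).1
    simp only [QoFam, Sum.elim_inr, Sum.elim_inl]
    rw [sub_eq_zero.mp hy] at heq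
    rw [C_neg]
    linear_combination heq
  · refine hspan j' j _ (x j') (-x j) hy ?_
    rw [C_sub, C_neg]
    linear_combination heq
end

section
/- Let 𝒬̃ = 𝒬₁ ∪ 𝒬₂ ∪ ℒ ⊆ ℂ[x₁,…,xₙ] be a (Q_o,m₁,m₂)-set with rank_s(Q_o) ≥ 100 and m₂ ≥ 1, where Q_j = Q_o + a_j·b_j for j ∈ {1,…,m₁}. Then there exist a polynomial P ∈ 𝒬₂, a scalar γ ∈ ℂ, and a homogeneous quadratic L with rank_s(L) = 2 and P = γ·Q_o + L, such that, setting V = MS(L) (so dim V ≤ 4), one has a_j ∈ V and b_j ∈ V for at least m₁ − m₂ of the indices j ∈ {1,…,m₁}. (The paper assumes rank_s(Q_o) ≥ rkq for an arbitrary sufficiently large absolute constant rkq; rkq = 100 suffices.) -/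
open MvPolynomial

/-- `MS Q` is the minimal space of `Q`: the span of the linear forms appearing in a
minimal representation of `Q`. -/
noncomputable def MS {σ : Type*} (Q : MvPolynomial σ ℂ) : Submodule ℂ (MvPolynomial σ ℂ) :=
  sInf {V : Submodule ℂ (MvPolynomial σ ℂ) | ∃ a b : Fin (rankS Q) → MvPolynomial σ ℂ,
    (∀ i, (a i).IsHomogeneous 1) ∧ (∀ i, (b i).IsHomogeneous 1) ∧ Q = ∑ i, a i * b i ∧
    V = Submodule.span ℂ (Set.range a ∪ Set.range b)}

section Homogeneous

variable {σ : Type*}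

/-- The substitution `X i ↦ X i * T`, which records the grading in the powers of `T`. -/
noncomputable def gradingHom :
    MvPolynomial σ ℂ →ₐ[ℂ] Polynomial (MvPolynomial σ ℂ) :=
  aeval fun i => Polynomial.C (X i) * Polynomial.X

lemma gradingHom_monomial (d : σ →₀ ℕ) (c : ℂ) :
    gradingHom (monomial d c) = Polynomial.C (monomial d c) * Polynomial.X ^ d.degree := by
  rw [gradingHom, aeval_monomial]
  simp only [mul_pow, Finsupp.prod_mul, monomial_eq, Polynomial.C_mul]
  simp only [Finsupp.prod, map_prod, map_pow, Finset.prod_pow_eq_pow_sum, Finsupp.degree_apply]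
  rw [mul_assoc]
  rfl

lemma gradingHom_of_isHomogeneous {F : MvPolynomial σ ℂ} {k : ℕ} (hF : F.IsHomogeneous k) :
    gradingHom F = Polynomial.C F * Polynomial.X ^ k := by
  conv_lhs => rw [F.as_sum]
  conv_rhs => rw [F.as_sum]
  rw [map_sum, map_sum, Finset.sum_mul]
  refine Finset.sum_congr rfl fun d hd => ?_
  rw [gradingHom_monomial, hF.degree_eq_sum_deg_support hd, Finsupp.degree_apply]

lemma coeff_gradingHom (F : MvPolynomial σ ℂ) (k : ℕ) :
    (gradingHom F).coeff k = homogeneousComponent k F := by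
  conv_lhs => rw [← sum_homogeneousComponent F]
  rw [map_sum, Polynomial.finsetSum_coeff]
  simp only [gradingHom_of_isHomogeneous (homogeneousComponent_isHomogeneous _ F),
    Polynomial.coeff_C_mul_X_pow]
  rw [Finset.sum_ite_eq]
  split_ifs with h
  · rfl
  · rw [homogeneousComponent_eq_zero]
    simpa using h

lemma homogeneousComponent_mul_of_isHomogeneous {F : MvPolynomial σ ℂ} {m : ℕ}
    (hF : F.IsHomogeneous m) (G : MvPolynomial σ ℂ) (k : ℕ) :
    homogeneousComponent (m + k) (F * G) = F * homogeneousComponent k G := by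
  rw [← coeff_gradingHom, map_mul, gradingHom_of_isHomogeneous hF, mul_assoc,
    Polynomial.coeff_C_mul, add_comm, Polynomial.coeff_X_pow_mul, coeff_gradingHom]

lemma gradingHom_ne_zero {F : MvPolynomial σ ℂ} (hF : F ≠ 0) : gradingHom F ≠ 0 := by
  intro h
  apply hF
  rw [← sum_homogeneousComponent F]
  refine Finset.sum_eq_zero fun k _ => ?_
  rw [← coeff_gradingHom, h, Polynomial.coeff_zero]

lemma isHomogeneous_of_natTrailingDegree_eq {F : MvPolynomial σ ℂ}
    (h : (gradingHom F).natTrailingDegree = (gradingHom F).natDegree) :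
    F.IsHomogeneous (gradingHom F).natDegree := by
  have key : F = homogeneousComponent (gradingHom F).natDegree F := by
    conv_lhs => rw [← sum_homogeneousComponent F]
    rw [Finset.sum_eq_single (gradingHom F).natDegree]
    · intro k _ hk
      rw [← coeff_gradingHom]
      rcases lt_or_gt_of_ne hk with hlt | hgt
      · exact Polynomial.coeff_eq_zero_of_lt_natTrailingDegree (h ▸ hlt)
      · exact Polynomial.coeff_eq_zero_of_natDegree_lt hgt
    · intro hk
      apply homogeneousComponent_eq_zero
      simpa using hk
  have h1 := homogeneousComponent_isHomogeneous (gradingHom F).natDegree F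
  rwa [← key] at h1

/-- Factors of a nonzero homogeneous polynomial are homogeneous. -/
lemma exists_isHomogeneous_of_mul {F G : MvPolynomial σ ℂ} {d : ℕ}
    (h : (F * G).IsHomogeneous d) (h0 : F * G ≠ 0) :
    ∃ i j, i + j = d ∧ F.IsHomogeneous i ∧ G.IsHomogeneous j := by
  have hF := gradingHom_ne_zero (left_ne_zero_of_mul h0)
  have hG := gradingHom_ne_zero (right_ne_zero_of_mul h0)
  have hprod : gradingHom F * gradingHom G = Polynomial.C (F * G) * Polynomial.X ^ d := by
    rw [← map_mul, gradingHom_of_isHomogeneous h]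
  have hdeg : (gradingHom F).natDegree + (gradingHom G).natDegree = d := by
    rw [← Polynomial.natDegree_mul hF hG, hprod, Polynomial.natDegree_C_mul_X_pow _ _ h0]
  have htr : (gradingHom F).natTrailingDegree + (gradingHom G).natTrailingDegree = d := by
    rw [← Polynomial.natTrailingDegree_mul hF hG, hprod, Polynomial.C_mul_X_pow_eq_monomial,
      Polynomial.natTrailingDegree_monomial h0]
  have h1 := Polynomial.natTrailingDegree_le_natDegree (gradingHom F)
  have h2 := Polynomial.natTrailingDegree_le_natDegree (gradingHom G)
  exact ⟨_, _, hdeg, isHomogeneous_of_natTrailingDegree_eq (by omega),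
    isHomogeneous_of_natTrailingDegree_eq (by omega)⟩

lemma isUnit_of_isHomogeneous_zero {F : MvPolynomial σ ℂ} (hF : F.IsHomogeneous 0)
    (h0 : F ≠ 0) : IsUnit F := by
  have h := (totalDegree_zero_iff_isHomogeneous σ).2 hF
  rw [totalDegree_eq_zero_iff_eq_C] at h
  rw [h]
  refine IsUnit.map C (isUnit_iff_ne_zero.2 fun hc => h0 ?_)
  rw [h, hc, C_0]

lemma not_isUnit_of_isHomogeneous {F : MvPolynomial σ ℂ} {d : ℕ} (hF : F.IsHomogeneous d)
    (hd : d ≠ 0) : ¬ IsUnit F := by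
  intro h
  obtain ⟨G, hG⟩ := h.exists_right_inv
  have h1 : constantCoeff F = 0 := by
    rw [constantCoeff_eq]
    exact hF.coeff_eq_zero (by simpa using hd.symm)
  have h2 := congrArg constantCoeff hG
  rw [map_mul, h1, zero_mul, map_one] at h2
  exact zero_ne_one h2

/-- If a form of degree `m` divides a form of degree `m + k`, the quotient can be taken
homogeneous of degree `k`. -/
lemma exists_isHomogeneous_quotient {F G e : MvPolynomial σ ℂ} {m k : ℕ}
    (hF : F.IsHomogeneous m) (hG : G.IsHomogeneous (m + k)) (h : G = F * e) :
    ∃ e', e'.IsHomogeneous k ∧ G = F * e' :=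
  ⟨homogeneousComponent k e, homogeneousComponent_isHomogeneous k e, by
    rw [← homogeneousComponent_mul_of_isHomogeneous hF, ← h, homogeneousComponent_eq_self hG]⟩

lemma exists_eq_smul_of_dvd {F G : MvPolynomial σ ℂ} {m : ℕ} (hF : F.IsHomogeneous m)
    (hG : G.IsHomogeneous m) (h : F ∣ G) : ∃ c : ℂ, G = c • F := by
  obtain ⟨e, he⟩ := h
  obtain ⟨e', he', rfl⟩ := exists_isHomogeneous_quotient (k := 0) hF hG he
  have h := (totalDegree_zero_iff_isHomogeneous σ).2 he'
  rw [totalDegree_eq_zero_iff_eq_C] at h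
  exact ⟨coeff 0 e', by rw [smul_eq_C_mul, ← h, mul_comm]⟩

lemma eq_zero_of_dvd_of_lt {F G : MvPolynomial σ ℂ} {m k : ℕ} (hF : F.IsHomogeneous m)
    (hG : G.IsHomogeneous k) (hkm : k < m) (h : F ∣ G) : G = 0 := by
  by_contra h0
  obtain ⟨e, rfl⟩ := h
  obtain ⟨i, j, hij, hi, -⟩ := exists_isHomogeneous_of_mul hG h0
  have := hi.inj_right hF (left_ne_zero_of_mul h0)
  omega

/-- A homogeneous element of degree two of the ideal of two quadratics is a scalar combination
of them. -/
lemma exists_smul_add_smul_of_mul_add_mul {A B K d e : MvPolynomial σ ℂ}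
    (hA : A.IsHomogeneous 2) (hB : B.IsHomogeneous 2) (hK : K.IsHomogeneous 2)
    (h : K = A * d + B * e) : ∃ α β : ℂ, K = α • A + β • B := by
  refine ⟨coeff 0 d, coeff 0 e, ?_⟩
  have h2 := congrArg (homogeneousComponent (2 + 0)) h
  rw [map_add, homogeneousComponent_mul_of_isHomogeneous hA,
    homogeneousComponent_mul_of_isHomogeneous hB, homogeneousComponent_eq_self hK,
    homogeneousComponent_zero, homogeneousComponent_zero] at h2
  rw [h2, smul_eq_C_mul, smul_eq_C_mul, mul_comm, mul_comm B]

end Homogeneous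

section Rank

variable {σ : Type*}

/-- `Q` is a sum of `r` products of two linear forms. -/
def IsSumOfProducts (r : ℕ) (Q : MvPolynomial σ ℂ) : Prop :=
  ∃ a b : Fin r → MvPolynomial σ ℂ,
    (∀ i, (a i).IsHomogeneous 1) ∧ (∀ i, (b i).IsHomogeneous 1) ∧ Q = ∑ i, a i * b i

lemma IsSumOfProducts.add {r s : ℕ} {P Q : MvPolynomial σ ℂ} (hP : IsSumOfProducts r P)
    (hQ : IsSumOfProducts s Q) : IsSumOfProducts (r + s) (P + Q) := by
  obtain ⟨a, b, ha, hb, rfl⟩ := hP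
  obtain ⟨c, d, hc, hd, rfl⟩ := hQ
  refine ⟨Fin.append a c, Fin.append b d, fun i => ?_, fun i => ?_, ?_⟩
  · refine Fin.addCases (fun j => ?_) (fun j => ?_) i
    · simpa using ha j
    · simpa using hc j
  · refine Fin.addCases (fun j => ?_) (fun j => ?_) i
    · simpa using hb j
    · simpa using hd j
  · simp [Fin.sum_univ_add]

lemma isHomogeneous_smul {F : MvPolynomial σ ℂ} {k : ℕ} (hF : F.IsHomogeneous k) (c : ℂ) :
    (c • F).IsHomogeneous k := by
  rw [smul_eq_C_mul]
  exact hF.C_mul c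

lemma IsSumOfProducts.smul {r : ℕ} {Q : MvPolynomial σ ℂ} (hQ : IsSumOfProducts r Q) (c : ℂ) :
    IsSumOfProducts r (c • Q) := by
  obtain ⟨a, b, ha, hb, rfl⟩ := hQ
  refine ⟨fun i => c • a i, b, fun i => isHomogeneous_smul (ha i) c, hb, ?_⟩
  simp [Finset.smul_sum]

lemma isSumOfProducts_zero (r : ℕ) : IsSumOfProducts r (0 : MvPolynomial σ ℂ) :=
  ⟨0, 0, fun _ => isHomogeneous_zero _ _ _, fun _ => isHomogeneous_zero _ _ _, by simp⟩

lemma IsSumOfProducts.mono {r s : ℕ} (h : r ≤ s) {Q : MvPolynomial σ ℂ}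
    (hQ : IsSumOfProducts r Q) : IsSumOfProducts s Q := by
  have h1 := hQ.add (isSumOfProducts_zero (s - r))
  rwa [add_zero, Nat.add_sub_cancel' h] at h1

lemma isSumOfProducts_mul {a b : MvPolynomial σ ℂ} (ha : a.IsHomogeneous 1)
    (hb : b.IsHomogeneous 1) : IsSumOfProducts 1 (a * b) :=
  ⟨fun _ => a, fun _ => b, fun _ => ha, fun _ => hb, by simp⟩

lemma IsSumOfProducts.exists_mul {Q : MvPolynomial σ ℂ} (hQ : IsSumOfProducts 1 Q) :
    ∃ a b : MvPolynomial σ ℂ, a.IsHomogeneous 1 ∧ b.IsHomogeneous 1 ∧ Q = a * b := by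
  obtain ⟨a, b, ha, hb, h⟩ := hQ
  exact ⟨a 0, b 0, ha 0, hb 0, by simpa using h⟩

lemma isSumOfProducts_one_of_dvd {Q l : MvPolynomial σ ℂ} (hQ : Q.IsHomogeneous 2)
    (hl : l.IsHomogeneous 1) (h : l ∣ Q) : IsSumOfProducts 1 Q := by
  obtain ⟨e, he⟩ := h
  obtain ⟨e', he', rfl⟩ := exists_isHomogeneous_quotient (k := 1) hl hQ he
  exact isSumOfProducts_mul hl he'

/-- A quadratic in the ideal of two linear forms is a sum of two products. -/
lemma isSumOfProducts_two_of_eq {Q l m e f : MvPolynomial σ ℂ} (hQ : Q.IsHomogeneous 2)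
    (hl : l.IsHomogeneous 1) (hm : m.IsHomogeneous 1) (h : Q = l * e + m * f) :
    IsSumOfProducts 2 Q := by
  have h2 := congrArg (homogeneousComponent (1 + 1)) h
  rw [map_add, homogeneousComponent_mul_of_isHomogeneous hl,
    homogeneousComponent_mul_of_isHomogeneous hm, homogeneousComponent_eq_self hQ] at h2
  rw [h2]
  exact (isSumOfProducts_mul hl (homogeneousComponent_isHomogeneous _ _)).add
    (isSumOfProducts_mul hm (homogeneousComponent_isHomogeneous _ _))

lemma exists_isSumOfProducts [Fintype σ] {Q : MvPolynomial σ ℂ} (hQ : Q.IsHomogeneous 2) :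
    ∃ r, IsSumOfProducts r Q := by
  let e := Fintype.equivFin σ
  refine ⟨Fintype.card σ, fun i => X (e.symm i), fun i => (2⁻¹ : ℂ) • pderiv (e.symm i) Q,
    fun i => isHomogeneous_X _ _, fun i => isHomogeneous_smul (hQ.pderiv (i := e.symm i)) _, ?_⟩
  rw [e.symm.sum_comp fun i => X i * ((2⁻¹ : ℂ) • pderiv i Q)]
  simp only [mul_smul_comm]
  rw [← Finset.smul_sum, hQ.sum_X_mul_pderiv, two_nsmul, ← two_smul ℂ, smul_smul]
  norm_num

lemma rankS_le_iff [Fintype σ] {Q : MvPolynomial σ ℂ} (hQ : Q.IsHomogeneous 2) {r : ℕ} :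
    rankS Q ≤ r ↔ IsSumOfProducts r Q := by
  refine ⟨fun h => ?_, fun h => Nat.sInf_le h⟩
  have h1 : IsSumOfProducts (rankS Q) Q := Nat.sInf_mem (exists_isSumOfProducts hQ)
  exact h1.mono h

end Rank

section LinearForm

variable {n : ℕ}

lemma exists_eq_sum_of_isHomogeneous_one {a : MvPolynomial (Fin n) ℂ} (ha : a.IsHomogeneous 1) :
    ∃ c : Fin n → ℂ, a = ∑ i, c i • X i := by
  rw [← mem_homogeneousSubmodule, homogeneousSubmodule_one_eq_span_X,
    Submodule.mem_span_range_iff_exists_fun] at ha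
  obtain ⟨c, hc⟩ := ha
  exact ⟨c, hc.symm⟩

lemma exists_linearMap_eval_eq {a : MvPolynomial (Fin n) ℂ} (ha : a.IsHomogeneous 1) :
    ∃ φ : (Fin n → ℂ) →ₗ[ℂ] ℂ, ∀ x, eval x a = φ x := by
  obtain ⟨c, rfl⟩ := exists_eq_sum_of_isHomogeneous_one ha
  refine ⟨∑ i, c i • LinearMap.proj i, fun x => ?_⟩
  simp [LinearMap.sum_apply]

lemma exists_isHomogeneous_one_eval_eq (φ : (Fin n → ℂ) →ₗ[ℂ] ℂ) :
    ∃ a : MvPolynomial (Fin n) ℂ, a.IsHomogeneous 1 ∧ ∀ x, eval x a = φ x := by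
  refine ⟨∑ i, φ (fun j => if i = j then 1 else 0) • X i,
    IsHomogeneous.sum _ _ _ fun i _ => isHomogeneous_smul (isHomogeneous_X _ _) _, fun x => ?_⟩
  rw [LinearMap.pi_apply_eq_sum_univ φ x]
  simp [mul_comm]

/-- The substitution projecting along the vector `p` to the hyperplane `l = 0`. -/
noncomputable def projectAlong (l : MvPolynomial (Fin n) ℂ) (p : Fin n → ℂ) :
    MvPolynomial (Fin n) ℂ →ₐ[ℂ] MvPolynomial (Fin n) ℂ :=
  aeval fun i => X i - C (p i) * l

lemma projectAlong_of_isHomogeneous_one (l : MvPolynomial (Fin n) ℂ) (p : Fin n → ℂ)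
    {a : MvPolynomial (Fin n) ℂ} (ha : a.IsHomogeneous 1) :
    projectAlong l p a = a - C (eval p a) * l := by
  obtain ⟨c, rfl⟩ := exists_eq_sum_of_isHomogeneous_one ha
  simp only [projectAlong, map_sum, smul_eq_C_mul, map_mul, algHom_C, algebraMap_eq, aeval_X,
    eval_C, eval_X, mul_sub, Finset.sum_sub_distrib, Finset.sum_mul, mul_assoc]

lemma isHomogeneous_projectAlong {l : MvPolynomial (Fin n) ℂ} (hl : l.IsHomogeneous 1)
    (p : Fin n → ℂ) {F : MvPolynomial (Fin n) ℂ} {k : ℕ} (hF : F.IsHomogeneous k) :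
    (projectAlong l p F).IsHomogeneous k := by
  have h := hF.aeval (fun i => X i - C (p i) * l) (n := 1) fun i =>
    (isHomogeneous_X _ _).sub (hl.C_mul _)
  rwa [one_mul] at h

lemma dvd_sub_projectAlong (l : MvPolynomial (Fin n) ℂ) (p : Fin n → ℂ)
    (F : MvPolynomial (Fin n) ℂ) : l ∣ F - projectAlong l p F := by
  rw [← Ideal.mem_span_singleton, ← Ideal.Quotient.mk_eq_mk_iff_sub_mem]
  have h : (Ideal.Quotient.mkₐ ℂ (Ideal.span {l})) =
      (Ideal.Quotient.mkₐ ℂ (Ideal.span {l})).comp (projectAlong l p) := by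
    ext i
    simp only [AlgHom.comp_apply, projectAlong, aeval_X, Ideal.Quotient.mkₐ_eq_mk]
    rw [Ideal.Quotient.mk_eq_mk_iff_sub_mem, Ideal.mem_span_singleton]
    exact ⟨C (p i), by ring⟩
  exact DFunLike.congr_fun h F

lemma projectAlong_self {l : MvPolynomial (Fin n) ℂ} (hl : l.IsHomogeneous 1) {p : Fin n → ℂ}
    (hp : eval p l = 1) : projectAlong l p l = 0 := by
  rw [projectAlong_of_isHomogeneous_one l p hl, hp, C_1, one_mul, sub_self]

lemma projectAlong_eq_zero_iff {l : MvPolynomial (Fin n) ℂ} (hl : l.IsHomogeneous 1)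
    {p : Fin n → ℂ} (hp : eval p l = 1) {F : MvPolynomial (Fin n) ℂ} :
    projectAlong l p F = 0 ↔ l ∣ F := by
  constructor
  · intro h
    simpa [h] using dvd_sub_projectAlong l p F
  · rintro ⟨G, rfl⟩
    rw [map_mul, projectAlong_self hl hp, zero_mul]

lemma exists_eval_eq_one {l : MvPolynomial (Fin n) ℂ} (hl : l.IsHomogeneous 1) (h0 : l ≠ 0) :
    ∃ p, eval p l = 1 := by
  obtain ⟨q, hq⟩ : ∃ q, eval q l ≠ 0 := by
    by_contra! h
    exact h0 (MvPolynomial.funext fun x => by simp [h])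
  obtain ⟨φ, hφ⟩ := exists_linearMap_eval_eq hl
  refine ⟨(eval q l)⁻¹ • q, ?_⟩
  rw [hφ, map_smul, ← hφ, smul_eq_mul, inv_mul_cancel₀ hq]

lemma prime_of_isHomogeneous_one {l : MvPolynomial (Fin n) ℂ} (hl : l.IsHomogeneous 1)
    (h0 : l ≠ 0) : Prime l := by
  obtain ⟨p, hp⟩ := exists_eval_eq_one hl h0
  refine ⟨h0, not_isUnit_of_isHomogeneous hl one_ne_zero, fun F G h => ?_⟩
  rw [← projectAlong_eq_zero_iff hl hp, map_mul, mul_eq_zero] at h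
  rwa [← projectAlong_eq_zero_iff hl hp, ← projectAlong_eq_zero_iff hl hp]

end LinearForm

section Polar

variable {n : ℕ}

/-- The derivative in the direction `p`. -/
noncomputable def polar (p : Fin n → ℂ) :
    Derivation ℂ (MvPolynomial (Fin n) ℂ) (MvPolynomial (Fin n) ℂ) :=
  mkDerivation ℂ fun i => C (p i)

lemma polar_of_isHomogeneous_one (p : Fin n → ℂ) {a : MvPolynomial (Fin n) ℂ}
    (ha : a.IsHomogeneous 1) : polar p a = C (eval p a) := by
  obtain ⟨c, rfl⟩ := exists_eq_sum_of_isHomogeneous_one ha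
  simp [polar, mkDerivation_X, smul_eq_C_mul]

lemma polar_sum_mul (p : Fin n → ℂ) {r : ℕ} {a b : Fin r → MvPolynomial (Fin n) ℂ}
    (ha : ∀ i, (a i).IsHomogeneous 1) (hb : ∀ i, (b i).IsHomogeneous 1) :
    polar p (∑ i, a i * b i) = ∑ i, (a i * C (eval p (b i)) + b i * C (eval p (a i))) := by
  simp only [map_sum, Derivation.leibniz, polar_of_isHomogeneous_one p (ha _),
    polar_of_isHomogeneous_one p (hb _), smul_eq_mul]

lemma isHomogeneous_polar (p : Fin n → ℂ) {Q : MvPolynomial (Fin n) ℂ}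
    (hQ : Q.IsHomogeneous 2) : (polar p Q).IsHomogeneous 1 := by
  obtain ⟨r, a, b, ha, hb, rfl⟩ := exists_isSumOfProducts hQ
  rw [polar_sum_mul p ha hb]
  refine IsHomogeneous.sum _ _ _ fun i _ => ?_
  rw [mul_comm, mul_comm (b i)]
  exact ((ha i).C_mul _).add ((hb i).C_mul _)

/-- Taylor expansion of a quadratic along the direction `p`. -/
lemma aeval_mul_X_sub (p : Fin n → ℂ) {Q : MvPolynomial (Fin n) ℂ} (hQ : Q.IsHomogeneous 2)
    (s t : MvPolynomial (Fin n) ℂ) :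
    aeval (fun i => s * X i - C (p i) * t) Q =
      s ^ 2 * Q - s * t * polar p Q + C (eval p Q) * t ^ 2 := by
  have hlin : ∀ a : MvPolynomial (Fin n) ℂ, a.IsHomogeneous 1 →
      aeval (fun i => s * X i - C (p i) * t) a = s * a - C (eval p a) * t := by
    intro a ha
    obtain ⟨c, rfl⟩ := exists_eq_sum_of_isHomogeneous_one ha
    simp only [map_sum, smul_eq_C_mul, map_mul, algHom_C, algebraMap_eq, aeval_X,
      eval_C, eval_X, mul_sub, Finset.sum_sub_distrib, Finset.sum_mul, Finset.mul_sum, mul_assoc,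
      mul_left_comm s]
  obtain ⟨r, a, b, ha, hb, rfl⟩ := exists_isSumOfProducts hQ
  rw [polar_sum_mul p ha hb]
  simp only [map_sum, map_mul, hlin _ (ha _), hlin _ (hb _), Finset.mul_sum, Finset.sum_mul]
  rw [← Finset.sum_sub_distrib, ← Finset.sum_add_distrib]
  exact Finset.sum_congr rfl fun i _ => by ring

/-- The polarization of a quadratic as a symmetric bilinear form. -/
lemma exists_bilinForm {Q : MvPolynomial (Fin n) ℂ} (hQ : Q.IsHomogeneous 2) :
    ∃ β : LinearMap.BilinForm ℂ (Fin n → ℂ), (∀ x y, β x y = β y x) ∧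
      (∀ x, 2 * eval x Q = β x x) ∧ ∀ x y, eval x (polar y Q) = β x y := by
  obtain ⟨r, a, b, ha, hb, rfl⟩ := exists_isSumOfProducts hQ
  choose φ hφ using fun i => exists_linearMap_eval_eq (ha i)
  choose ψ hψ using fun i => exists_linearMap_eval_eq (hb i)
  refine ⟨∑ i, ((LinearMap.mul ℂ ℂ).compl₁₂ (φ i) (ψ i) +
    (LinearMap.mul ℂ ℂ).compl₁₂ (ψ i) (φ i)), fun x y => ?_, fun x => ?_, fun x y => ?_⟩
  · simp only [LinearMap.sum_apply, LinearMap.add_apply, LinearMap.compl₁₂_apply,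
      LinearMap.mul_apply']
    exact Finset.sum_congr rfl fun i _ => by ring
  · simp only [LinearMap.sum_apply, LinearMap.add_apply, LinearMap.compl₁₂_apply,
      LinearMap.mul_apply', map_sum, map_mul, hφ, hψ, Finset.mul_sum]
    exact Finset.sum_congr rfl fun i _ => by ring
  · rw [polar_sum_mul y ha hb]
    simp only [LinearMap.sum_apply, LinearMap.add_apply, LinearMap.compl₁₂_apply,
      LinearMap.mul_apply', map_sum, map_mul, map_add, hφ, hψ, eval_C]

/-- A quadratic that is not a sum of fewer than `k` products admits `k` orthonormal vectors. -/
lemma exists_orthonormal {Q : MvPolynomial (Fin n) ℂ}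
    {β : LinearMap.BilinForm ℂ (Fin n → ℂ)} (hsymm : ∀ x y, β x y = β y x)
    (hβ : ∀ x, 2 * eval x Q = β x x) (k : ℕ) (hk : ∀ m < k, ¬ IsSumOfProducts m Q) :
    ∃ e : Fin k → Fin n → ℂ, ∀ i j, β (e i) (e j) = if i = j then 1 else 0 := by
  induction k with
  | zero => exact ⟨fun i => i.elim0, fun i => i.elim0⟩
  | succ k ih =>
    obtain ⟨e, he⟩ := ih fun m hm => hk m (hm.trans k.lt_succ_self)
    choose a ha haβ using fun i => exists_isHomogeneous_one_eval_eq (β (e i))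
    obtain ⟨v, hv⟩ : ∃ v, β v v ≠ ∑ i, β v (e i) * β v (e i) := by
      by_contra! h
      refine hk k k.lt_succ_self ⟨fun i => (2⁻¹ : ℂ) • a i, a,
        fun i => isHomogeneous_smul (ha i) _, ha, MvPolynomial.funext fun x => ?_⟩
      have h1 : eval x Q = 2⁻¹ * (2 * eval x Q) := by ring
      rw [h1, hβ, h x, Finset.mul_sum, map_sum]
      exact Finset.sum_congr rfl fun i _ => by simp [smul_eval, haβ, hsymm (e i) x]
    let w := v - ∑ i, β v (e i) • e i
    have hwe : ∀ j, β w (e j) = 0 := by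
      intro j
      simp [w, LinearMap.sum_apply, he]
    have hww : β w w = β v v - ∑ i, β v (e i) * β v (e i) := by
      have h1 : β w w = β w v := by
        conv_lhs => rw [show β w w = β w (v - ∑ i, β v (e i) • e i) from rfl]
        simp [hwe]
      rw [h1]
      simp [w, LinearMap.sum_apply, hsymm _ v]
    obtain ⟨z, hz⟩ := IsAlgClosed.exists_pow_nat_eq (β w w) (n := 2) two_pos
    have hz0 : z ≠ 0 := by
      rintro rfl
      rw [hww] at hz
      exact hv (sub_eq_zero.1 (by rw [← hz]; ring))
    refine ⟨Fin.snoc e (z⁻¹ • w), fun i j => ?_⟩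
    refine Fin.lastCases ?_ (fun i => ?_) i <;> refine Fin.lastCases ?_ (fun j => ?_) j
    · simp only [Fin.snoc_last, map_smul, LinearMap.smul_apply, smul_eq_mul, ← hz, if_true]
      field_simp
    · simp [hwe, (Fin.castSucc_lt_last j).ne']
    · simp [hsymm (e i), hwe, (Fin.castSucc_lt_last i).ne]
    · simp [he]

lemma exists_binary_quadratic_zero (x y z : ℂ) :
    ∃ s t : ℂ, (s ≠ 0 ∨ t ≠ 0) ∧ x * s ^ 2 + y * (s * t) + z * t ^ 2 = 0 := by
  by_cases hx : x = 0
  · exact ⟨1, 0, Or.inl one_ne_zero, by simp [hx]⟩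
  · obtain ⟨d, hd⟩ := IsAlgClosed.exists_pow_nat_eq (discrim x y z) (n := 2) two_pos
    obtain ⟨s, hs⟩ := exists_quadratic_eq_zero hx ⟨d, by rw [← hd, sq]⟩
    exact ⟨s, 1, Or.inr one_ne_zero, by linear_combination hs⟩

/-- Two quadratics, the first of which is not a sum of three products, have a common zero at
which the first one is smooth. -/
lemma exists_common_zero_polar_ne_zero {A B : MvPolynomial (Fin n) ℂ} (hA : A.IsHomogeneous 2)
    (hB : B.IsHomogeneous 2) (hA3 : ¬ IsSumOfProducts 3 A) :
    ∃ p : Fin n → ℂ, eval p A = 0 ∧ eval p B = 0 ∧ polar p A ≠ 0 := by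
  obtain ⟨β, hsymm, hβ, hpol⟩ := exists_bilinForm hA
  obtain ⟨β', hsymm', hβ', -⟩ := exists_bilinForm hB
  obtain ⟨e, he⟩ := exists_orthonormal hsymm hβ 4
    fun m hm h => hA3 (h.mono (Nat.lt_succ_iff.1 hm))
  let u := e 0 + Complex.I • e 1
  let v := e 2 + Complex.I • e 3
  obtain ⟨s, t, hst, h0⟩ := exists_binary_quadratic_zero (β' u u) (2 * β' u v) (β' v v)
  refine ⟨s • u + t • v, ?_, ?_, fun hp => ?_⟩
  · have h1 := hβ (s • u + t • v)
    have h2 : β (s • u + t • v) (s • u + t • v) = 0 := by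
      simp [u, v, he]
      linear_combination (s ^ 2 + t ^ 2) * Complex.I_mul_I
    rw [h2] at h1
    simpa using h1
  · have h1 := hβ' (s • u + t • v)
    have h2 : β' (s • u + t • v) (s • u + t • v) = 0 := by
      simp only [map_add, map_smul, LinearMap.add_apply, LinearMap.smul_apply, smul_eq_mul,
        hsymm' v u]
      linear_combination h0
    rw [h2] at h1
    simpa using h1
  · have hs := hpol (e 0) (s • u + t • v)
    have ht := hpol (e 2) (s • u + t • v)
    rw [hp] at hs ht
    simp [u, v, he] at hs ht
    exact hst.elim (fun h => h hs.symm) fun h => h ht.symm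

end Polar

section Pencil

variable {n : ℕ} {A B a b : MvPolynomial (Fin n) ℂ}

lemma prime_of_not_isSumOfProducts_one (hA : A.IsHomogeneous 2) (h : ¬ IsSumOfProducts 1 A) :
    Prime A := by
  have h0 : A ≠ 0 := by
    rintro rfl
    exact h (isSumOfProducts_zero 1)
  refine Irreducible.prime ⟨not_isUnit_of_isHomogeneous hA two_ne_zero, fun F G hFG => ?_⟩
  subst hFG
  obtain ⟨i, j, hij, hF, hG⟩ := exists_isHomogeneous_of_mul hA h0
  have hi : i = 0 ∨ (i = 1 ∧ j = 1) ∨ j = 0 := by omega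
  rcases hi with rfl | ⟨rfl, rfl⟩ | rfl
  · exact Or.inl (isUnit_of_isHomogeneous_zero hF (left_ne_zero_of_mul h0))
  · exact absurd (isSumOfProducts_mul hF hG) h
  · exact Or.inr (isUnit_of_isHomogeneous_zero hG (right_ne_zero_of_mul h0))

lemma not_dvd_of_not_isSumOfProducts_two (hA : A.IsHomogeneous 2) (hA2 : ¬ IsSumOfProducts 2 A)
    (ha : a.IsHomogeneous 1) : ¬ a ∣ A := fun h =>
  hA2 ((isSumOfProducts_one_of_dvd hA ha h).mono one_le_two)

/-- A quadratic which is not a sum of two products stays prime on a hyperplane. -/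
lemma prime_projectAlong (hA : A.IsHomogeneous 2) (hA2 : ¬ IsSumOfProducts 2 A)
    (ha : a.IsHomogeneous 1) (p : Fin n → ℂ) : Prime (projectAlong a p A) := by
  refine prime_of_not_isSumOfProducts_one (isHomogeneous_projectAlong ha p hA) fun h => ?_
  obtain ⟨c, d, hc, -, hcd⟩ := h.exists_mul
  obtain ⟨e, he⟩ := dvd_sub_projectAlong a p A
  refine hA2 (isSumOfProducts_two_of_eq hA ha hc (e := e) (f := d) ?_)
  rw [← hcd, ← he, sub_add_cancel]

/-- On a hyperplane, a quadratic which is not a sum of two products is not divisible by the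
restriction of a linear form. -/
lemma not_projectAlong_dvd (hA : A.IsHomogeneous 2) (hA2 : ¬ IsSumOfProducts 2 A)
    (ha : a.IsHomogeneous 1) (hb : b.IsHomogeneous 1) (p : Fin n → ℂ) :
    ¬ projectAlong a p b ∣ projectAlong a p A := by
  rintro ⟨f, hf⟩
  obtain ⟨e, he⟩ := dvd_sub_projectAlong a p A
  refine hA2 (isSumOfProducts_two_of_eq hA ha (isHomogeneous_projectAlong ha p hb)
    (e := e) (f := f) ?_)
  rw [← hf, ← he, sub_add_cancel]

/-- The cubic obtained by eliminating a variable from two quadratics has no linear factor. -/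
lemma not_dvd_mul_sub_mul (hA : A.IsHomogeneous 2) (hB : B.IsHomogeneous 2)
    (ha : a.IsHomogeneous 1) (hb : b.IsHomogeneous 1) (hA2 : ¬ IsSumOfProducts 2 A)
    (hAB : ∀ c : ℂ, ¬ IsSumOfProducts 1 (B - c • A)) (ha0 : a ≠ 0) (hba : ∀ c : ℂ, b ≠ c • a)
    {l : MvPolynomial (Fin n) ℂ} (hl : l.IsHomogeneous 1) (hl0 : l ≠ 0) :
    ¬ l ∣ b * A - a * B := by
  intro h
  obtain ⟨q, hq⟩ := exists_eval_eq_one hl hl0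
  rw [← projectAlong_eq_zero_iff hl hq, map_sub, map_mul, map_mul, sub_eq_zero] at h
  have hpA : projectAlong l q A ≠ 0 := (prime_projectAlong hA hA2 hl q).ne_zero
  by_cases hpa : projectAlong l q a = 0
  · rw [hpa, zero_mul, mul_eq_zero, or_iff_left hpA, projectAlong_eq_zero_iff hl hq] at h
    rw [projectAlong_eq_zero_iff hl hq] at hpa
    obtain ⟨s, rfl⟩ := exists_eq_smul_of_dvd hl ha hpa
    obtain ⟨t, rfl⟩ := exists_eq_smul_of_dvd hl hb h
    have hs : s ≠ 0 := by
      rintro rfl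
      exact ha0 (zero_smul _ _)
    exact hba (t / s) (by rw [smul_smul, div_mul_cancel₀ _ hs])
  · have hprime := prime_of_isHomogeneous_one (isHomogeneous_projectAlong hl q ha) hpa
    rcases hprime.dvd_or_dvd (Dvd.intro _ h.symm) with h1 | h1
    · obtain ⟨c, hc⟩ := exists_eq_smul_of_dvd (isHomogeneous_projectAlong hl q ha)
        (isHomogeneous_projectAlong hl q hb) h1
      rw [hc, smul_mul_assoc, ← mul_smul_comm] at h
      have h2 := mul_left_cancel₀ hpa h
      rw [← map_smul, eq_comm, ← sub_eq_zero, ← map_sub, projectAlong_eq_zero_iff hl hq] at h2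
      exact hAB c (isSumOfProducts_one_of_dvd (hB.sub (isHomogeneous_smul hA c)) hl h2)
    · exact not_projectAlong_dvd hA hA2 hl ha q h1

lemma prime_mul_sub_mul (hA : A.IsHomogeneous 2) (hB : B.IsHomogeneous 2)
    (ha : a.IsHomogeneous 1) (hb : b.IsHomogeneous 1) (hA2 : ¬ IsSumOfProducts 2 A)
    (hAB : ∀ c : ℂ, ¬ IsSumOfProducts 1 (B - c • A)) (ha0 : a ≠ 0) (hba : ∀ c : ℂ, b ≠ c • a) :
    Prime (b * A - a * B) := by
  have hlin := @not_dvd_mul_sub_mul n A B a b hA hB ha hb hA2 hAB ha0 hba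
  have hhom : (b * A - a * B).IsHomogeneous 3 := (hb.mul hA).sub (ha.mul hB)
  have h0 : b * A - a * B ≠ 0 := fun h => hlin ha ha0 (h ▸ dvd_zero a)
  refine Irreducible.prime ⟨not_isUnit_of_isHomogeneous hhom three_ne_zero, fun F G hFG => ?_⟩
  rw [hFG] at hlin hhom h0
  have hF0 := left_ne_zero_of_mul h0
  have hG0 := right_ne_zero_of_mul h0
  obtain ⟨i, j, hij, hF, hG⟩ := exists_isHomogeneous_of_mul hhom h0
  have hi : i = 0 ∨ i = 1 ∨ j = 1 ∨ j = 0 := by omega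
  rcases hi with rfl | rfl | rfl | rfl
  · exact Or.inl (isUnit_of_isHomogeneous_zero hF hF0)
  · exact absurd (dvd_mul_right F G) (hlin hF hF0)
  · exact absurd (dvd_mul_left G F) (hlin hG hG0)
  · exact Or.inr (isUnit_of_isHomogeneous_zero hG hG0)

lemma exists_eq_mul_add_mul_of_cubic_dvd (hA : A.IsHomogeneous 2)
    (ha : a.IsHomogeneous 1) (hb : b.IsHomogeneous 1) (hA2 : ¬ IsSumOfProducts 2 A)
    (ha0 : a ≠ 0) (hba : ∀ c : ℂ, b ≠ c • a) {K k : MvPolynomial (Fin n) ℂ} {c : ℂ}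
    (h : b * A - a * B ∣ a ^ 2 * K - a * A * k + C c * A ^ 2) :
    ∃ d e, K = A * d + B * e := by
  obtain ⟨h, hh⟩ := h
  obtain ⟨q, hq⟩ := exists_eval_eq_one ha ha0
  have hpA : projectAlong a q A ≠ 0 := (prime_projectAlong hA hA2 ha q).ne_zero
  have hpb : projectAlong a q b ≠ 0 := by
    rw [Ne, projectAlong_eq_zero_iff ha hq]
    intro hab
    obtain ⟨t, ht⟩ := exists_eq_smul_of_dvd ha hb hab
    exact hba t ht
  have hmod := congrArg (projectAlong a q) hh
  simp only [map_add, map_sub, map_mul, map_pow, projectAlong_self ha hq, algHom_C,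
    algebraMap_eq] at hmod
  have hmod' : C c * projectAlong a q A = projectAlong a q b * projectAlong a q h :=
    mul_left_cancel₀ hpA (by linear_combination hmod)
  have hc : c = 0 := by
    by_contra hc
    apply not_projectAlong_dvd hA hA2 ha hb q
    refine ⟨C c⁻¹ * projectAlong a q h, ?_⟩
    rw [mul_left_comm, ← hmod', ← mul_assoc, ← C_mul, inv_mul_cancel₀ hc, C_1, one_mul]
  subst hc
  rw [C_0, zero_mul, zero_eq_mul, or_iff_right hpb, projectAlong_eq_zero_iff ha hq] at hmod'
  obtain ⟨h', rfl⟩ := hmod'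
  have h1 : A * (k + b * h') = a * (K + B * h') := by
    refine mul_left_cancel₀ ha0 ?_
    rw [C_0] at hh
    linear_combination -hh
  rcases (prime_of_isHomogeneous_one ha ha0).dvd_or_dvd (Dvd.intro _ h1.symm) with h2 | ⟨d, hd⟩
  · exact absurd h2 (not_dvd_of_not_isSumOfProducts_two hA hA2 ha)
  · refine ⟨d, -h', mul_left_cancel₀ ha0 ?_⟩
    rw [hd] at h1
    linear_combination -h1

lemma exists_eq_mul_add_mul_of_quadratic_dvd (hA : A.IsHomogeneous 2) (hB : B.IsHomogeneous 2)
    (ha : a.IsHomogeneous 1) (hA2 : ¬ IsSumOfProducts 2 A)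
    (hAB : ∀ c : ℂ, ¬ IsSumOfProducts 1 (B - c • A)) (ha0 : a ≠ 0)
    {K k : MvPolynomial (Fin n) ℂ} (hk : k.IsHomogeneous 1) {c : ℂ}
    (h : B ∣ a ^ 2 * K - a * A * k + C c * A ^ 2) :
    ∃ d e, K = A * d + B * e := by
  obtain ⟨h, hh⟩ := h
  obtain ⟨q, hq⟩ := exists_eval_eq_one ha ha0
  have hprime := prime_projectAlong hA hA2 ha q
  have hndvd : ¬ projectAlong a q A ∣ projectAlong a q B := by
    intro hdvd
    obtain ⟨t, ht⟩ := exists_eq_smul_of_dvd (isHomogeneous_projectAlong ha q hA)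
      (isHomogeneous_projectAlong ha q hB) hdvd
    rw [← map_smul, ← sub_eq_zero, ← map_sub, projectAlong_eq_zero_iff ha hq] at ht
    exact hAB t (isSumOfProducts_one_of_dvd (hB.sub (isHomogeneous_smul hA t)) ha ht)
  have hpB : projectAlong a q B ≠ 0 := fun h0 => hndvd (h0 ▸ dvd_zero _)
  have hcancel : ∀ f g : MvPolynomial (Fin n) ℂ,
      projectAlong a q A * f = projectAlong a q B * g →
        ∃ g', g = projectAlong a q A * g' ∧ f = projectAlong a q B * g' := by
    intro f g hfg
    obtain ⟨g', rfl⟩ := (hprime.dvd_or_dvd (Dvd.intro _ hfg)).resolve_left hndvd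
    exact ⟨g', rfl, mul_left_cancel₀ hprime.ne_zero (by linear_combination hfg)⟩
  have hmod := congrArg (projectAlong a q) hh
  simp only [map_add, map_sub, map_mul, map_pow, projectAlong_self ha hq, algHom_C,
    algebraMap_eq] at hmod
  obtain ⟨h1, hh1, hc1⟩ := hcancel (projectAlong a q A * C c) (projectAlong a q h)
    (by linear_combination hmod)
  obtain ⟨h2, hh2, hc2⟩ := hcancel _ _ hc1
  have hc : c = 0 := by
    have h3 := eq_zero_of_dvd_of_lt (isHomogeneous_projectAlong ha q hB) (isHomogeneous_C _ c)
      two_pos ⟨h2, hc2⟩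
    rwa [C_eq_zero] at h3
  subst hc
  rw [C_0, zero_eq_mul, or_iff_right hpB] at hc2
  rw [hh2, hc2, mul_zero] at hh1
  rw [mul_zero, projectAlong_eq_zero_iff ha hq] at hh1
  obtain ⟨h', rfl⟩ := hh1
  have hh' : a * K - A * k = B * h' := by
    refine mul_left_cancel₀ ha0 ?_
    rw [C_0] at hh
    linear_combination hh
  have hmod' := congrArg (projectAlong a q) hh'
  simp only [map_sub, map_mul, projectAlong_self ha hq] at hmod'
  obtain ⟨g, hg, hkg⟩ := hcancel (-projectAlong a q k) (projectAlong a q h')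
    (by linear_combination hmod')
  have hk0 := eq_zero_of_dvd_of_lt (isHomogeneous_projectAlong ha q hB)
    (isHomogeneous_projectAlong ha q hk).neg one_lt_two ⟨g, hkg⟩
  rw [hk0, zero_eq_mul, or_iff_right hpB] at hkg
  rw [neg_eq_zero, projectAlong_eq_zero_iff ha hq] at hk0
  rw [hkg, mul_zero, projectAlong_eq_zero_iff ha hq] at hg
  obtain ⟨d, rfl⟩ := hk0
  obtain ⟨e, rfl⟩ := hg
  exact ⟨d, e, mul_left_cancel₀ ha0 (by linear_combination hh')⟩

/-- If a product of quadratics vanishes on the intersection of two quadrics, the first of large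
rank and no member of the pencil being reducible, then one of the quadratics lies in the
pencil. -/
theorem exists_eq_smul_add_smul_of_prod_mem_radical (hA : A.IsHomogeneous 2)
    (hB : B.IsHomogeneous 2) (hA3 : ¬ IsSumOfProducts 3 A)
    (hAB : ∀ c : ℂ, ¬ IsSumOfProducts 1 (B - c • A)) {ι : Type*} (s : Finset ι)
    (K : ι → MvPolynomial (Fin n) ℂ) (hK : ∀ k ∈ s, (K k).IsHomogeneous 2)
    (h : ∏ k ∈ s, K k ∈ (Ideal.span {A, B}).radical) :
    ∃ k ∈ s, ∃ α β : ℂ, K k = α • A + β • B := by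
  have hA2 : ¬ IsSumOfProducts 2 A := fun h2 => hA3 (h2.mono (Nat.le_succ 2))
  obtain ⟨p, hpA, hpB, ha0⟩ := exists_common_zero_polar_ne_zero hA hB hA3
  have ha := isHomogeneous_polar p hA
  set Φ := aeval (R := ℂ) fun i => polar p A * X i - C (p i) * A
  have hΦK : ∀ Q : MvPolynomial (Fin n) ℂ, Q.IsHomogeneous 2 → Φ Q =
      polar p A ^ 2 * Q - polar p A * A * polar p Q + C (eval p Q) * A ^ 2 :=
    fun Q hQ => aeval_mul_X_sub p hQ _ _
  have key : ∀ π : MvPolynomial (Fin n) ℂ, Prime π → π ∣ Φ A → π ∣ Φ B →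
      ∃ k ∈ s, π ∣ Φ (K k) := by
    intro π hπ h1 h2
    obtain ⟨N, hN⟩ := h
    have hle : Ideal.span {A, B} ≤ (Ideal.span {π}).comap Φ := by
      rw [Ideal.span_le]
      rintro x (rfl | rfl)
      · exact Ideal.mem_span_singleton.2 h1
      · exact Ideal.mem_span_singleton.2 h2
    have h3 := Ideal.mem_span_singleton.1 (Ideal.mem_comap.1 (hle hN))
    rw [map_pow, map_prod] at h3
    exact hπ.exists_mem_finset_dvd (hπ.dvd_of_dvd_pow h3)
  have hΦA : Φ A = 0 := by
    rw [hΦK A hA, hpA, C_0]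
    ring
  by_cases hba : ∃ c : ℂ, polar p B = c • polar p A
  · obtain ⟨c, hc⟩ := hba
    have hB' : (B - c • A).IsHomogeneous 2 := hB.sub (isHomogeneous_smul hA c)
    have hΦB : Φ B = (B - c • A) * polar p A ^ 2 := by
      rw [hΦK B hB, hpB, hc, C_0, smul_eq_C_mul, smul_eq_C_mul]
      ring
    obtain ⟨k, hk, hdvd⟩ := key (B - c • A) (prime_of_not_isSumOfProducts_one hB' (hAB c))
      (hΦA ▸ dvd_zero _) (hΦB ▸ dvd_mul_right _ _)
    rw [hΦK _ (hK k hk)] at hdvd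
    obtain ⟨d, e, hde⟩ := exists_eq_mul_add_mul_of_quadratic_dvd hA hB' ha hA2
      (fun t => by rw [sub_sub, ← add_smul]; exact hAB _) ha0 (isHomogeneous_polar p (hK k hk)) hdvd
    refine ⟨k, hk, exists_smul_add_smul_of_mul_add_mul (d := d - C c * e) (e := e)
      hA hB (hK k hk) ?_⟩
    rw [hde, smul_eq_C_mul]
    ring
  · push Not at hba
    have hb := isHomogeneous_polar p hB
    have hΦB : Φ B = (polar p B * A - polar p A * B) * -polar p A := by
      rw [hΦK B hB, hpB, C_0]
      ring
    obtain ⟨k, hk, hdvd⟩ := key _ (prime_mul_sub_mul hA hB ha hb hA2 hAB ha0 hba)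
      (hΦA ▸ dvd_zero _) (hΦB ▸ dvd_mul_right _ _)
    rw [hΦK _ (hK k hk)] at hdvd
    obtain ⟨d, e, hde⟩ := exists_eq_mul_add_mul_of_cubic_dvd hA ha hb hA2 ha0 hba hdvd
    exact ⟨k, hk, exists_smul_add_smul_of_mul_add_mul hA hB (hK k hk) hde⟩

end Pencil

section MinimalSpace

variable {n : ℕ}

lemma IsSumOfProducts.projectAlong {l : MvPolynomial (Fin n) ℂ} (hl : l.IsHomogeneous 1)
    (p : Fin n → ℂ) {r : ℕ} {Q : MvPolynomial (Fin n) ℂ} (hQ : IsSumOfProducts r Q) :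
    IsSumOfProducts r (projectAlong l p Q) := by
  obtain ⟨a, b, ha, hb, rfl⟩ := hQ
  exact ⟨fun i => _root_.projectAlong l p (a i), fun i => _root_.projectAlong l p (b i),
    fun i => isHomogeneous_projectAlong hl p (ha i),
    fun i => isHomogeneous_projectAlong hl p (hb i), by simp only [map_sum, map_mul]⟩

/-- A linear form occurring in a minimal representation of `L` lies in the minimal space. -/
lemma mem_MS {L a b Q : MvPolynomial (Fin n) ℂ} {m : ℕ} (ha : a.IsHomogeneous 1)
    (hL : L = a * b + Q) (hQ : IsSumOfProducts m Q) (hm : m < rankS L) : a ∈ MS L := by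
  rw [MS, Submodule.mem_sInf]
  rintro V ⟨c, d, hc, hd, hcd, rfl⟩
  by_contra hmem
  obtain ⟨f, hfa, hf⟩ := Submodule.exists_le_ker_of_notMem hmem
  have heval : ∀ l : MvPolynomial (Fin n) ℂ, l.IsHomogeneous 1 →
      eval (fun i => f (X i) / f a) l = f l / f a := by
    intro l hl
    obtain ⟨t, rfl⟩ := exists_eq_sum_of_isHomogeneous_one hl
    simp [smul_eval, Finset.sum_div, mul_div_assoc]
  have hfix : ∀ l : MvPolynomial (Fin n) ℂ, l.IsHomogeneous 1 → l ∈ Set.range c ∪ Set.range d →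
      projectAlong a (fun i => f (X i) / f a) l = l := by
    intro l hl hmem
    have hfl : f l = 0 := hf (Submodule.subset_span hmem)
    rw [projectAlong_of_isHomogeneous_one a _ hl, heval l hl, hfl, zero_div, C_0, zero_mul,
      sub_zero]
  have hLfix : projectAlong a (fun i => f (X i) / f a) L = L := by
    rw [hcd, map_sum]
    refine Finset.sum_congr rfl fun i _ => ?_
    rw [map_mul, hfix _ (hc i) (Or.inl ⟨i, rfl⟩), hfix _ (hd i) (Or.inr ⟨i, rfl⟩)]
  have ha1 : eval (fun i => f (X i) / f a) a = 1 := by rw [heval a ha, div_self hfa]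
  have hLm : IsSumOfProducts m L := by
    rw [← hLfix, hL, map_add, map_mul, projectAlong_self ha ha1, zero_mul, zero_add]
    exact hQ.projectAlong ha _
  exact absurd (Nat.sInf_le hLm) (not_le.2 hm)

lemma finrank_MS_le {L : MvPolynomial (Fin n) ℂ} (hL : L.IsHomogeneous 2) :
    Module.finrank ℂ (MS L) ≤ rankS L + rankS L := by
  obtain ⟨a, b, ha, hb, h⟩ := (rankS_le_iff hL).1 le_rfl
  have hle : MS L ≤ Submodule.span ℂ (Set.range (Sum.elim a b)) :=
    sInf_le ⟨a, b, ha, hb, h, by rw [Set.Sum.elim_range]⟩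
  have : FiniteDimensional ℂ (Submodule.span ℂ (Set.range (Sum.elim a b))) :=
    FiniteDimensional.span_of_finite ℂ (Set.finite_range _)
  refine (Submodule.finrank_mono hle).trans ((finrank_range_le_card _).trans ?_)
  simp

end MinimalSpace

section CloseQuadratics

variable {n : ℕ}

/-- `P` is a combination of `Q`, of the product `a * b`, and of one further product of linear
forms. -/
def IsCombination (P Q a b : MvPolynomial (Fin n) ℂ) : Prop :=
  ∃ (γ δ : ℂ) (c d : MvPolynomial (Fin n) ℂ), c.IsHomogeneous 1 ∧ d.IsHomogeneous 1 ∧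
    P = γ • Q + δ • (a * b) + c * d

lemma isCombination_of_eq {P Q a b F c d : MvPolynomial (Fin n) ℂ} {x α β : ℂ}
    (hc : c.IsHomogeneous 1) (hd : d.IsHomogeneous 1) (hF : F = x • Q + c * d)
    (hF' : F = α • (Q + a * b) + β • P) (hind : LinearIndependent ℂ ![Q + a * b, F]) :
    IsCombination P Q a b := by
  have hβ : β ≠ 0 := by
    rintro rfl
    rw [LinearIndependent.pair_iff] at hind
    have := (hind α (-1) (by rw [hF']; module)).2
    norm_num at this
  refine ⟨β⁻¹ * (x - α), -(β⁻¹ * α), β⁻¹ • c, d, isHomogeneous_smul hc _, hd, ?_⟩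
  have h1 : β • P = x • Q + c * d - α • (Q + a * b) := by rw [← hF, hF']; module
  have h2 : P = β⁻¹ • (β • P) := by rw [smul_smul, inv_mul_cancel₀ hβ, one_smul]
  rw [h2, h1, smul_mul_assoc]
  module

lemma isCombination_of_eq_of_eq {P Q K a b a' b' : MvPolynomial (Fin n) ℂ} {α β α' β' : ℂ}
    (ha' : a'.IsHomogeneous 1) (hb' : b'.IsHomogeneous 1) (hα' : α' ≠ 0)
    (h : K = α • (Q + a * b) + β • P) (h' : K = α' • (Q + a' * b') + β' • P)
    (hind : LinearIndependent ℂ ![Q + a * b, Q + a' * b']) : IsCombination P Q a b := by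
  refine isCombination_of_eq (F := Q + a' * b') (x := 1) (α := α'⁻¹ * α) (β := α'⁻¹ * (β - β'))
    ha' hb' (by rw [one_smul]) ?_ hind
  have h1 : α' • (Q + a' * b') = α • (Q + a * b) + (β - β') • P := by
    rw [sub_smul, ← add_sub_assoc, ← h, h', add_sub_cancel_right]
  rw [mul_smul, mul_smul, ← smul_add, ← h1, smul_smul, inv_mul_cancel₀ hα', one_smul]

end CloseQuadratics

section QoSet

variable {n m₁ m₂ r : ℕ} {Qo : MvPolynomial (Fin n) ℂ} {Qs : Fin m₁ → MvPolynomial (Fin n) ℂ}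
  {Ps : Fin m₂ → MvPolynomial (Fin n) ℂ} {ls : Fin r → MvPolynomial (Fin n) ℂ}
  {a b : Fin m₁ → MvPolynomial (Fin n) ℂ}

/-- In a `(Q_o,m₁,m₂)`-set, either `P_i` is close to `Q_o` through `a_j * b_j`, or the pencil of
`Q_j` and `P_i` contains another member of `𝒬₂`. -/
lemma IsQoSet.isCombination_or_exists (hset : IsQoSet m₁ m₂ r Qo Qs Ps ls)
    (hQo : ¬ IsSumOfProducts 4 Qo)
    (ha : ∀ j, (a j).IsHomogeneous 1) (hb : ∀ j, (b j).IsHomogeneous 1)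
    (hQ : ∀ j, Qs j = Qo + a j * b j) (i : Fin m₂) (j : Fin m₁) :
    IsCombination (Ps i) Qo (a j) (b j) ∨
      ∃ (k : Fin m₂) (α β : ℂ), α ≠ 0 ∧ Ps k = α • (Qo + a j * b j) + β • Ps i := by
  obtain ⟨⟨hQoh, -⟩, hQs, hPs, hls, hind, hrad, -⟩ := hset
  by_cases hred : ∃ c : ℂ, IsSumOfProducts 1 (Ps i - c • Qs j)
  · left
    obtain ⟨c, hc⟩ := hred
    obtain ⟨e, f, he, hf, hef⟩ := hc.exists_mul
    refine ⟨c, c, e, f, he, hf, ?_⟩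
    rw [← hef, hQ]
    module
  push Not at hred
  have hQj : ¬ IsSumOfProducts 3 (Qs j) := by
    intro h
    apply hQo
    have h1 := h.add ((isSumOfProducts_mul (ha j) (hb j)).smul (-1))
    rwa [hQ, neg_one_smul, add_neg_cancel_right] at h1
  obtain ⟨k, hk, α, β, hK⟩ := exists_eq_smul_add_smul_of_prod_mem_radical (hQs j).1 (hPs i).1
    hQj hred _ (QoFam Qo Qs Ps ls) (by
      rintro (_ | k | k | k) _
      · exact hQoh
      · exact (hQs k).1
      · exact (hPs k).1
      · exact (hls k).pow 2) (hrad (Sum.inr (Sum.inl j)) (Sum.inr (Sum.inr (Sum.inl i))) (by simp))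
  rw [Finset.mem_erase, Finset.mem_erase] at hk
  obtain ⟨hki, hkj, -⟩ := hk
  have hindj := hind _ _ hkj.symm
  rw [show QoFam Qo Qs Ps ls (Sum.inr (Sum.inl j)) = Qo + a j * b j from hQ j] at hindj
  rw [hQ] at hK
  rcases k with _ | k | k | k
  · exact Or.inl (isCombination_of_eq (x := 1) (isHomogeneous_zero _ _ _)
      (isHomogeneous_zero _ _ _) (by simp [QoFam]) hK hindj)
  · exact Or.inl (isCombination_of_eq (x := 1) (ha k) (hb k) (by simp [QoFam, hQ]) hK hindj)
  · refine Or.inr ⟨k, α, β, ?_, hK⟩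
    rintro rfl
    have hindi := hind _ _ hki
    rw [LinearIndependent.pair_iff] at hindi
    have := (hindi 1 (-β) (by rw [hK]; simp [QoFam])).1
    norm_num at this
  · exact Or.inl (isCombination_of_eq (x := 0) (hls k) (hls k) (by simp [QoFam, sq]) hK hindj)

lemma IsQoSet.ncard_not_isCombination_le (hset : IsQoSet m₁ m₂ r Qo Qs Ps ls)
    (hQo : ¬ IsSumOfProducts 4 Qo)
    (ha : ∀ j, (a j).IsHomogeneous 1) (hb : ∀ j, (b j).IsHomogeneous 1)
    (hQ : ∀ j, Qs j = Qo + a j * b j) (i : Fin m₂) :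
    {j | ¬ IsCombination (Ps i) Qo (a j) (b j)}.ncard ≤ m₂ := by
  have h : ∀ j, ∃ k : Fin m₂, ¬ IsCombination (Ps i) Qo (a j) (b j) →
      ∃ α β : ℂ, α ≠ 0 ∧ Ps k = α • (Qo + a j * b j) + β • Ps i := by
    intro j
    rcases hset.isCombination_or_exists hQo ha hb hQ i j with h | ⟨k, h⟩
    · exact ⟨i, fun h' => absurd h h'⟩
    · exact ⟨k, fun _ => h⟩
  choose k hk using h
  have hinj : Set.InjOn k {j | ¬ IsCombination (Ps i) Qo (a j) (b j)} := by
    intro j hj j' hj' hjj'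
    by_contra hne
    obtain ⟨α, β, -, h⟩ := hk j hj
    obtain ⟨α', β', hα', h'⟩ := hk j' hj'
    rw [← hjj'] at h'
    have hind := hset.2.2.2.2.1 (Sum.inr (Sum.inl j)) (Sum.inr (Sum.inl j')) (by simpa using hne)
    simp only [QoFam, Sum.elim_inr, Sum.elim_inl, hQ] at hind
    exact hj (isCombination_of_eq_of_eq (ha j') (hb j') hα' h h' hind)
  have h1 := Set.ncard_le_ncard_of_injOn k (t := Set.univ) (fun _ _ => Set.mem_univ _) hinj
  simpa [Set.ncard_univ] using h1

end QoSet

/-- Claim 5.9 of the paper. For a `(Q_o,m₁,m₂)`-set with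
`rank_s(Q_o) ≥ 100` and `m₂ ≥ 1`, where `Q_j = Q_o + a_j·b_j`, there are `P ∈ 𝒬₂`, a
scalar `γ` and a quadratic `L` of `rank_s` equal to `2` with `P = γ·Q_o + L`, such that,
with `V = MS(L)` (of dimension at most `4`), at least `m₁ − m₂` of the indices
`j ∈ {1,…,m₁}` satisfy `a_j ∈ V` and `b_j ∈ V`. -/
theorem statement19 {n m₁ m₂ r : ℕ} (Qo : MvPolynomial (Fin n) ℂ)
    (Qs : Fin m₁ → MvPolynomial (Fin n) ℂ) (Ps : Fin m₂ → MvPolynomial (Fin n) ℂ)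
    (ls : Fin r → MvPolynomial (Fin n) ℂ)
    (a b : Fin m₁ → MvPolynomial (Fin n) ℂ)
    (hset : IsQoSet m₁ m₂ r Qo Qs Ps ls)
    (hrk : 100 ≤ rankS Qo) (hm₂ : 1 ≤ m₂)
    (ha : ∀ j, (a j).IsHomogeneous 1) (hb : ∀ j, (b j).IsHomogeneous 1)
    (hQ : ∀ j, Qs j = Qo + a j * b j) :
    ∃ (i : Fin m₂) (γ : ℂ) (L : MvPolynomial (Fin n) ℂ),
      L.IsHomogeneous 2 ∧ rankS L = 2 ∧ Ps i = γ • Qo + L ∧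
      Module.finrank ℂ (MS L) ≤ 4 ∧
      m₁ - m₂ ≤ Set.ncard {j : Fin m₁ | a j ∈ MS L ∧ b j ∈ MS L} := by
  have hQo : Qo.IsHomogeneous 2 := hset.1.1
  have hQo4 : ¬ IsSumOfProducts 4 Qo := fun h => by
    have := (rankS_le_iff hQo).2 h
    omega
  let i : Fin m₂ := ⟨0, hm₂⟩
  have hP : (Ps i).IsHomogeneous 2 := (hset.2.2.1 i).1
  have hm : 5 * m₂ + 2 < m₁ := hset.2.2.2.2.2.2.1
  have hbad := hset.ncard_not_isCombination_le hQo4 ha hb hQ i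
  have hgood : m₁ - m₂ ≤ {j | IsCombination (Ps i) Qo (a j) (b j)}.ncard := by
    have h := Set.ncard_add_ncard_compl {j | IsCombination (Ps i) Qo (a j) (b j)}
    rw [Nat.card_eq_fintype_card, Fintype.card_fin, Set.compl_ofPred] at h
    omega
  obtain ⟨j₀, γ, δ, c, d, hc, hd, hγ⟩ :
      {j | IsCombination (Ps i) Qo (a j) (b j)}.Nonempty := by
    rw [← Set.ncard_pos]
    omega
  have hLhom : (Ps i - γ • Qo).IsHomogeneous 2 := hP.sub (isHomogeneous_smul hQo γ)
  have hLeq : Ps i - γ • Qo = δ • (a j₀ * b j₀) + c * d := by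
    rw [hγ]
    module
  have hL2 : IsSumOfProducts 2 (Ps i - γ • Qo) := by
    rw [hLeq]
    exact ((isSumOfProducts_mul (ha j₀) (hb j₀)).smul δ).add (isSumOfProducts_mul hc hd)
  have hrank : rankS (Ps i - γ • Qo) = 2 := by
    refine le_antisymm ((rankS_le_iff hLhom).2 hL2) ?_
    have h := hset.2.2.2.2.2.2.2.2.1 i 1 (-γ) (by simp)
    rwa [one_smul, neg_smul, ← sub_eq_add_neg] at h
  refine ⟨i, γ, Ps i - γ • Qo, hLhom, hrank, (add_sub_cancel _ _).symm, ?_, ?_⟩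
  · have h := finrank_MS_le hLhom
    rwa [hrank] at h
  refine hgood.trans (Set.ncard_le_ncard ?_)
  rintro j ⟨γ', δ', c', d', hc', hd', hγ'⟩
  have hγγ' : γ' = γ := by
    by_contra hne
    apply hQo4
    have h1 := (hL2.add ((((isSumOfProducts_mul (ha j) (hb j)).smul δ').add
      (isSumOfProducts_mul hc' hd')).smul (-1))).smul (γ' - γ)⁻¹
    have h2 : Ps i - γ • Qo + (-1 : ℂ) • (δ' • (a j * b j) + c' * d') = (γ' - γ) • Qo := by
      rw [hγ']
      module
    rwa [h2, smul_smul, inv_mul_cancel₀ (sub_ne_zero.2 hne), one_smul] at h1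
  subst hγγ'
  have hprod := isSumOfProducts_mul hc' hd'
  have hlt : 1 < rankS (Ps i - γ' • Qo) := by
    rw [hrank]
    exact one_lt_two
  have hab : Ps i - γ' • Qo = a j * (δ' • b j) + c' * d' := by
    rw [hγ', mul_smul_comm]
    module
  have hba : Ps i - γ' • Qo = b j * (δ' • a j) + c' * d' := by
    rw [hab, mul_smul_comm, mul_smul_comm, mul_comm (a j)]
  exact ⟨mem_MS (ha j) hab hprod hlt, mem_MS (hb j) hba hprod hlt⟩
end
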